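/- arXiv:1504.00660 — 2 statements merged into one kernel-verified Lean document; each statement's English description precedes it below -/
import Mathlib

section
/- Let q : [0,1] → ℝ be continuous, nonpositive (q(x) ≤ 0 on [0,1]) and single-barrier, and set q₋ = min{q(x) : x ∈ [0,1]}. Let λ₁ < λ₂ < ⋯ denote the eigenvalues of the Dirichlet problem −y'' + q(x) y = λ y on [0,1] with y(0) = y(1) = 0. If for two different indices n ≠ m with λ_n > λ_m ≥ −2q₋ equality λ_n / λ_m = n² / m² holds, then q ≡ 0 on [0,1] (and conversely, if q ≡ 0 then λ_n / λ_m = n² / m² for all n, m). -/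
/-- `lam` is an eigenvalue of the Dirichlet problem `−y'' + q y = λ y` on `[a, b]`,
`y a = y b = 0`: there is a nontrivial solution (with derivative `y'` and
`y'' = (q − λ) y` on `[a, b]`) satisfying the boundary conditions. -/
def IsDirichletEigenvalue (q : ℝ → ℝ) (a b lam : ℝ) : Prop :=
  ∃ y y' : ℝ → ℝ,
    (∀ x ∈ Set.Icc a b, HasDerivAt y (y' x) x) ∧
    (∀ x ∈ Set.Icc a b, HasDerivAt y' ((q x - lam) * y x) x) ∧
    (∃ x ∈ Set.Icc a b, y x ≠ 0) ∧
    y a = 0 ∧ y b = 0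

section

open Real Set Filter Topology

theorem three_mul_sin_lt {u : ℝ} (hu : 0 < u) : 3 * sin u < u * (2 + cos u) := by
  rcases le_or_gt π u with h | h
  · have h1 := sin_le_one u
    have h2 := neg_one_le_cos u
    have h3 := pi_gt_three
    nlinarith
  · have key : StrictMonoOn (fun x : ℝ => x * (2 + cos x) - 3 * sin x) (Icc 0 π) := by
      apply strictMonoOn_of_deriv_pos (convex_Icc 0 π) (by fun_prop)
      intro x hx
      rw [interior_Icc] at hx
      have hd : HasDerivAt (fun x : ℝ => x * (2 + cos x) - 3 * sin x)
          (1 * (2 + cos x) + x * (-sin x) - 3 * cos x) x :=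
        ((hasDerivAt_id x).mul ((hasDerivAt_cos x).const_add 2)).sub
          ((hasDerivAt_sin x).const_mul 3)
      rw [hd.deriv]
      have hx2 : x = 2 * (x / 2) := by ring
      set t := x / 2 with ht
      have ht0 : 0 < t := by have := hx.1; linarith
      have ht1 : t < π / 2 := by have := hx.2; linarith
      have hs : 0 < sin t := sin_pos_of_pos_of_lt_pi ht0 (by linarith [pi_pos])
      have hc : 0 < cos t := cos_pos_of_mem_Ioo ⟨by linarith, ht1⟩
      have htan := lt_tan ht0 ht1
      rw [tan_eq_sin_div_cos, lt_div_iff₀ hc] at htan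
      rw [hx2, sin_two_mul, cos_two_mul']
      nlinarith [mul_pos hs (sub_pos.2 htan), sin_sq_add_cos_sq t]
    have := key ⟨le_rfl, pi_pos.le⟩ ⟨hu.le, h.le⟩ hu
    simp at this
    linarith

/-- Minus the derivative, with respect to `k ^ 2`, of the time at which the solution of
`y'' + k ^ 2 y = 0`, `y 0 = 0` reaches a given Prüfer angle, as a function of that time. -/
theorem strictAntiOn_delay {X : ℝ} (hX : 0 < X) :
    StrictAntiOn (fun k : ℝ => (2 * k * X - sin (2 * k * X)) / (4 * k ^ 3)) (Ioi 0) := by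
  have hd : ∀ k ∈ Ioi (0 : ℝ), HasDerivAt
      (fun k : ℝ => (2 * k * X - sin (2 * k * X)) / (4 * k ^ 3))
      (((2 * X - cos (2 * k * X) * (2 * X)) * (4 * k ^ 3) -
        (2 * k * X - sin (2 * k * X)) * (4 * (3 * k ^ 2))) / (4 * k ^ 3) ^ 2) k := by
    intro k hk
    have hk0 : (0 : ℝ) < k := hk
    have h1 : HasDerivAt (fun k : ℝ => 2 * k * X) (2 * X) k := by
      simpa using ((hasDerivAt_id k).const_mul 2).mul_const X
    have h2 : HasDerivAt (fun k : ℝ => 4 * k ^ 3) (4 * (3 * k ^ 2)) k := by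
      simpa using (hasDerivAt_pow 3 k).const_mul (4 : ℝ)
    exact (h1.sub h1.sin).div h2 (by positivity)
  apply strictAntiOn_of_deriv_neg (convex_Ioi 0)
    (fun k hk => (hd k hk).continuousAt.continuousWithinAt)
  intro k hk
  rw [interior_Ioi] at hk
  have hk0 : (0 : ℝ) < k := hk
  rw [(hd k hk).deriv]
  apply div_neg_of_neg_of_pos _ (by positivity)
  have h := three_mul_sin_lt (u := 2 * k * X) (by positivity)
  have : 0 < 4 * k ^ 2 * (2 * k * X * (2 + cos (2 * k * X)) - 3 * sin (2 * k * X)) :=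
    mul_pos (by positivity) (by linarith)
  nlinarith

/-- Change of scale in the Prüfer angle: if `tan a = y / y'` then
`tan (rescaleAngle k a) = k * y / y'`, and both angles have the same number of half-turns. -/
noncomputable def rescaleAngle (k a : ℝ) : ℝ :=
  a + arctan ((k - 1) * (sin a * cos a) / (cos a ^ 2 + k * sin a ^ 2))

theorem cos_sq_add_mul_sin_sq_pos {k : ℝ} (hk : 0 < k) (a : ℝ) :
    0 < cos a ^ 2 + k * sin a ^ 2 := by
  rcases eq_or_ne (sin a) 0 with h | h
  · have := sin_sq_add_cos_sq a
    rw [h] at this ⊢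
    nlinarith
  · positivity

theorem rescaleAngle_int_mul_pi (k : ℝ) (n : ℤ) : rescaleAngle k (n * π) = n * π := by
  simp [rescaleAngle, sin_int_mul_pi]

theorem rescaleAngle_zero (k : ℝ) : rescaleAngle k 0 = 0 := by
  simp [rescaleAngle]

theorem rescaleAngle_nat_mul_pi_sub (k a : ℝ) (n : ℕ) :
    rescaleAngle k (n * π - a) = n * π - rescaleAngle k a := by
  have hs : sin (n * π - a) * cos (n * π - a) = -(sin a * cos a) := by
    have h := sin_two_mul (n * π - a)
    have h2 := sin_two_mul a
    rw [show 2 * (n * π - a) = n * (2 * π) - 2 * a by ring, sin_nat_mul_two_pi_sub] at h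
    linarith
  have hs2 : sin (n * π - a) ^ 2 = sin a ^ 2 := by
    rw [sin_sq_eq_half_sub, sin_sq_eq_half_sub,
      show 2 * (n * π - a) = n * (2 * π) - 2 * a by ring, cos_nat_mul_two_pi_sub]
  have hc2 : cos (n * π - a) ^ 2 = cos a ^ 2 := by
    rw [cos_sq', cos_sq', hs2]
  rw [rescaleAngle, rescaleAngle, hs, hs2, hc2, mul_neg, neg_div, arctan_neg]
  ring

theorem abs_rescaleAngle_sub_lt (k a : ℝ) : |rescaleAngle k a - a| < π / 2 := by
  rw [rescaleAngle, add_sub_cancel_left, abs_lt]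
  exact ⟨neg_pi_div_two_lt_arctan _, arctan_lt_pi_div_two _⟩

theorem exists_sin_cos_rescaleAngle {k : ℝ} (hk : 0 < k) (a : ℝ) :
    ∃ r : ℝ, 0 < r ∧ sin (rescaleAngle k a) = r * (k * sin a) ∧
      cos (rescaleAngle k a) = r * cos a := by
  have hD := cos_sq_add_mul_sin_sq_pos hk a
  set D := cos a ^ 2 + k * sin a ^ 2 with hDdef
  set u := (k - 1) * (sin a * cos a) / D with hu
  have hsq : 0 < √(1 + u ^ 2) := by positivity
  have huD : u * D = (k - 1) * (sin a * cos a) := div_mul_cancel₀ _ hD.ne'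
  have hsc := sin_sq_add_cos_sq a
  refine ⟨1 / (D * √(1 + u ^ 2)), by positivity, ?_, ?_⟩
  · rw [rescaleAngle, ← hDdef, ← hu, sin_add, sin_arctan, cos_arctan]
    have : sin a + cos a * u = k * sin a / D := by
      rw [eq_div_iff hD.ne']
      linear_combination cos a * huD + sin a * hDdef + k * sin a * hsc
    field_simp
    field_simp at this
    linarith
  · rw [rescaleAngle, ← hDdef, ← hu, cos_add, sin_arctan, cos_arctan]
    have : cos a - sin a * u = cos a / D := by
      rw [eq_div_iff hD.ne']
      linear_combination -sin a * huD + cos a * hDdef + cos a * hsc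
    field_simp
    field_simp at this
    linarith

theorem sq_rescaleAngle {k : ℝ} (hk : 0 < k) (a : ℝ) :
    sin (rescaleAngle k a) ^ 2 = k ^ 2 * sin a ^ 2 / (cos a ^ 2 + k ^ 2 * sin a ^ 2) ∧
    cos (rescaleAngle k a) ^ 2 = cos a ^ 2 / (cos a ^ 2 + k ^ 2 * sin a ^ 2) ∧
    sin (rescaleAngle k a) * cos (rescaleAngle k a) =
      k * (sin a * cos a) / (cos a ^ 2 + k ^ 2 * sin a ^ 2) := by
  obtain ⟨r, hr, hs, hc⟩ := exists_sin_cos_rescaleAngle hk a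
  have hD := cos_sq_add_mul_sin_sq_pos (pow_pos hk 2) a
  have h1 := sin_sq_add_cos_sq (rescaleAngle k a)
  rw [hs, hc] at h1 ⊢
  have h2 : r ^ 2 = 1 / (cos a ^ 2 + k ^ 2 * sin a ^ 2) := by
    rw [eq_div_iff hD.ne']; linarith
  refine ⟨?_, ?_, ?_⟩
  · linear_combination k ^ 2 * sin a ^ 2 * h2
  · linear_combination cos a ^ 2 * h2
  · linear_combination k * (sin a * cos a) * h2

theorem rescaleAngle_inv_rescaleAngle {k l : ℝ} (hk : 0 < k) (hl : 0 < l) (hkl : k * l = 1)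
    (a : ℝ) : rescaleAngle l (rescaleAngle k a) = a := by
  obtain ⟨r, hr, hs, hc⟩ := exists_sin_cos_rescaleAngle hk a
  obtain ⟨r', hr', hs', hc'⟩ := exists_sin_cos_rescaleAngle hl (rescaleAngle k a)
  set b := rescaleAngle l (rescaleAngle k a) with hb
  have hs2 : sin b = r' * r * sin a := by
    rw [hs', hs]; linear_combination r' * r * sin a * hkl
  have hc2 : cos b = r' * r * cos a := by rw [hc', hc]; ring
  have hcos : cos (b - a) = r' * r := by
    rw [cos_sub, hs2, hc2]; linear_combination r' * r * sin_sq_add_cos_sq a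
  have hsin : sin (b - a) = 0 := by
    rw [sin_sub, hs2, hc2]; ring
  have h1 := abs_lt.1 (abs_rescaleAngle_sub_lt k a)
  have h2 := abs_lt.1 (abs_rescaleAngle_sub_lt l (rescaleAngle k a))
  have := (sin_eq_zero_iff_of_lt_of_lt (x := b - a) (by linarith) (by linarith)).1 hsin
  linarith

theorem hasDerivAt_rescaleAngle {k a : ℝ → ℝ} {k' a' t : ℝ} (hk : HasDerivAt k k' t)
    (ha : HasDerivAt a a' t) (hpos : 0 < k t) :
    HasDerivAt (fun t => rescaleAngle (k t) (a t))
      ((k t * a' + sin (a t) * cos (a t) * k') / (cos (a t) ^ 2 + k t ^ 2 * sin (a t) ^ 2)) t := by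
  have hD := cos_sq_add_mul_sin_sq_pos hpos (a t)
  have hD2 := cos_sq_add_mul_sin_sq_pos (pow_pos hpos 2) (a t)
  have hN := (hk.sub_const 1).mul (ha.sin.mul ha.cos)
  have hDd := (ha.cos.pow 2).add (hk.mul (ha.sin.pow 2))
  have h := ha.add ((hN.div hDd hD.ne').arctan)
  refine h.congr_deriv ?_
  simp only [Pi.mul_apply, Pi.add_apply, Pi.div_apply, Pi.pow_apply]
  have hu : 1 + ((k t - 1) * (sin (a t) * cos (a t)) /
      (cos (a t) ^ 2 + k t * sin (a t) ^ 2)) ^ 2 =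
      (cos (a t) ^ 2 + k t ^ 2 * sin (a t) ^ 2) / (cos (a t) ^ 2 + k t * sin (a t) ^ 2) ^ 2 := by
    rw [eq_div_iff (by positivity), add_mul, ← mul_pow, div_mul_cancel₀ _ hD.ne']
    have h1 := sin_sq_add_cos_sq (a t)
    have h2 : cos (a t) ^ 2 = 1 - sin (a t) ^ 2 := by linarith
    rw [mul_pow, mul_pow, h2]
    ring
  rw [hu]
  rw [one_div_mul_eq_div, div_div_div_cancel_right₀ (pow_ne_zero 2 hD.ne'), eq_div_iff hD2.ne',
    add_mul, div_mul_cancel₀ _ hD2.ne']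
  push_cast
  linear_combination (a' * ((k t - 1) * (cos (a t) ^ 2 - k t * sin (a t) ^ 2) + k t) +
    k' * (sin (a t) * cos (a t))) * sin_sq_add_cos_sq (a t)

theorem strictMono_rescaleAngle {k : ℝ} (hk : 0 < k) : StrictMono (rescaleAngle k) := by
  refine strictMono_of_deriv_pos fun a => ?_
  have h := hasDerivAt_rescaleAngle (hasDerivAt_const a k) (hasDerivAt_id a) hk
  change HasDerivAt (rescaleAngle k) _ a at h
  rw [h.deriv]
  have := cos_sq_add_mul_sin_sq_pos (pow_pos hk 2) a
  simp only [id]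
  apply div_pos _ this
  linarith

/-- The right-hand side of the Prüfer equation `a' = cos² a + Λ sin² a`. -/
noncomputable def prueferField (Λ a : ℝ) : ℝ := cos a ^ 2 + Λ * sin a ^ 2

theorem abs_prueferField_sub_le (Λ a b : ℝ) :
    |prueferField Λ a - prueferField Λ b| ≤ |Λ - 1| * |a - b| := by
  have h : prueferField Λ a - prueferField Λ b = (Λ - 1) * (sin (a - b) * sin (a + b)) := by
    rw [prueferField, prueferField, sin_sub, sin_add, cos_sq', cos_sq']
    have h1 := cos_sq' a
    have h2 := cos_sq' b
    linear_combination -(Λ - 1) * sin a ^ 2 * h2 + (Λ - 1) * sin b ^ 2 * h1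
  rw [h, abs_mul, abs_mul]
  gcongr
  have h1 : |sin (a - b)| ≤ |a - b| := abs_sin_le_abs
  have h2 := abs_sin_le_one (a + b)
  nlinarith [abs_nonneg (sin (a - b)), abs_nonneg (sin (a + b))]

/-- The Prüfer angle, for the spectral parameter `lam`, that is reached under the constant
potential `s` at the same time as the angle `a` for the spectral parameter `nu`. -/
noncomputable def transportAngle (lam nu s a : ℝ) : ℝ :=
  rescaleAngle (1 / √(lam - s)) (√(lam - s) * (rescaleAngle √(nu - s) a / √(nu - s)))

theorem rescaleAngle_transportAngle {lam nu s : ℝ} (h : s < lam) (a : ℝ) :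
    rescaleAngle √(lam - s) (transportAngle lam nu s a) =
      √(lam - s) * (rescaleAngle √(nu - s) a / √(nu - s)) := by
  have hk : 0 < √(lam - s) := sqrt_pos.2 (by linarith)
  exact rescaleAngle_inv_rescaleAngle (by positivity) hk (by field_simp) _

theorem transportAngle_zero (lam nu s : ℝ) : transportAngle lam nu s 0 = 0 := by
  simp [transportAngle, rescaleAngle_zero]

theorem hasDerivAt_transportAngle_comp {lam nu s : ℝ} (hlam : s < lam) (hnu : s < nu)
    {a : ℝ → ℝ} {t : ℝ} (ha : HasDerivAt a (prueferField (nu - s) (a t)) t) :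
    HasDerivAt (fun t => transportAngle lam nu s (a t))
      (prueferField (lam - s) (transportAngle lam nu s (a t))) t := by
  have hk : 0 < √(lam - s) := sqrt_pos.2 (by linarith)
  have hl : 0 < √(nu - s) := sqrt_pos.2 (by linarith)
  have hk2 : √(lam - s) ^ 2 = lam - s := sq_sqrt (by linarith)
  have hl2 : √(nu - s) ^ 2 = nu - s := sq_sqrt (by linarith)
  have h1 := hasDerivAt_rescaleAngle (hasDerivAt_const t √(nu - s)) ha hl
  have h2 := hasDerivAt_rescaleAngle (hasDerivAt_const t (1 / √(lam - s)))
    ((h1.div_const √(nu - s)).const_mul √(lam - s)) (by positivity)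
  refine h2.congr_deriv ?_
  have hi : 0 < 1 / √(lam - s) := by positivity
  obtain ⟨hs, hc, -⟩ := sq_rescaleAngle hi
    (√(lam - s) * (rescaleAngle √(nu - s) (a t) / √(nu - s)))
  simp only [prueferField, transportAngle]
  rw [hs, hc]
  set k := √(lam - s)
  set l := √(nu - s)
  rw [← hl2, ← hk2]
  have hD := cos_sq_add_mul_sin_sq_pos (pow_pos hl 2) (a t)
  set b := k * (rescaleAngle l (a t) / l)
  have hD2 := cos_sq_add_mul_sin_sq_pos (pow_pos hi 2) b
  have hsc := sin_sq_add_cos_sq b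
  set D := cos (a t) ^ 2 + l ^ 2 * sin (a t) ^ 2
  set D2 := cos b ^ 2 + (1 / k) ^ 2 * sin b ^ 2
  field_simp
  linear_combination -(l * (cos (a t) ^ 2 + l ^ 2 * sin (a t) ^ 2)) * hsc

theorem exists_hasDerivAt_transportAngle {lam nu s : ℝ} (hlam : nu < lam) (hnu : s < nu)
    (a : ℝ) : ∃ d : ℝ, HasDerivAt (fun s => transportAngle lam nu s a) d s ∧
      (0 ≤ a → 0 ≤ d) ∧ (0 < a → 0 < d) := by
  have hk : 0 < √(lam - s) := sqrt_pos.2 (by linarith)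
  have hl : 0 < √(nu - s) := sqrt_pos.2 (by linarith)
  have hlk : √(nu - s) < √(lam - s) := sqrt_lt_sqrt (by linarith) (by linarith)
  have hi : 0 < 1 / √(lam - s) := by positivity
  have hk1 : HasDerivAt (fun s => √(lam - s)) (-1 / (2 * √(lam - s))) s :=
    ((hasDerivAt_id s).const_sub lam).sqrt (by simp; linarith)
  have hl1 : HasDerivAt (fun s => √(nu - s)) (-1 / (2 * √(nu - s))) s :=
    ((hasDerivAt_id s).const_sub nu).sqrt (by simp; linarith)
  have h1 := hasDerivAt_rescaleAngle hl1 (hasDerivAt_const s a) hl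
  have h2 := hasDerivAt_rescaleAngle ((hasDerivAt_const s (1 : ℝ)).div hk1 hk.ne')
    (hk1.mul (h1.div hl1 hl.ne')) (by simpa using hk)
  refine ⟨_, h2, ?_⟩
  simp only [Pi.mul_apply, Pi.div_apply]
  obtain ⟨-, -, hsc⟩ := sq_rescaleAngle hl a
  set k := √(lam - s)
  set l := √(nu - s)
  have hD := cos_sq_add_mul_sin_sq_pos (pow_pos hl 2) a
  set X := rescaleAngle l a / l with hX
  have hlX : rescaleAngle l a = l * X := by rw [hX]; field_simp
  rw [hlX] at hsc ⊢
  set D := cos a ^ 2 + l ^ 2 * sin a ^ 2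
  have hD2 := cos_sq_add_mul_sin_sq_pos (pow_pos hi 2) (k * X)
  have key : (1 / k * (-1 / (2 * k) * X + k * (((l * 0 + sin a * cos a * (-1 / (2 * l))) / D * l -
      l * X * (-1 / (2 * l))) / l ^ 2)) + sin (k * X) * cos (k * X) *
      ((0 * k - 1 * (-1 / (2 * k))) / k ^ 2)) =
      (2 * l * X - sin (2 * l * X)) / (4 * l ^ 3) -
        (2 * k * X - sin (2 * k * X)) / (4 * k ^ 3) := by
    have e : sin a * cos a / D = sin (l * X) * cos (l * X) / l := by
      rw [hsc]; field_simp
    rw [mul_assoc 2 l, mul_assoc 2 k, sin_two_mul, sin_two_mul]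
    have e2 : (l * 0 + sin a * cos a * (-1 / (2 * l))) / D =
      (sin a * cos a / D) * (-1 / (2 * l)) := by ring
    rw [e2, e]
    field_simp
    ring
  rw [key]
  have hpos : 0 < a → 0 < (2 * l * X - sin (2 * l * X)) / (4 * l ^ 3) -
      (2 * k * X - sin (2 * k * X)) / (4 * k ^ 3) := fun ha => by
    have hX0 : 0 < X := by
      have := strictMono_rescaleAngle hl ha
      rw [rescaleAngle_zero, hlX] at this
      exact pos_of_mul_pos_right this hl.le
    exact sub_pos.2 (strictAntiOn_delay hX0 hl hk hlk)
  refine ⟨fun ha => ?_, fun ha => div_pos (hpos ha) hD2⟩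
  rcases ha.eq_or_lt with rfl | ha
  · have : X = 0 := by simp [hX, rescaleAngle_zero]
    simp [this]
  · exact (div_pos (hpos ha) hD2).le

theorem contDiffAt_transportAngle {lam nu s : ℝ} (hlam : s < lam) (hnu : s < nu) (a : ℝ) :
    ContDiffAt ℝ 1 (fun x : ℝ × ℝ => transportAngle lam nu x.1 x.2) (s, a) := by
  have hk : 0 < √(lam - s) := sqrt_pos.2 (by linarith)
  have hl : 0 < √(nu - s) := sqrt_pos.2 (by linarith)
  have hi : 0 < 1 / √(lam - s) := by positivity
  have hre : ∀ {k b : ℝ × ℝ → ℝ} {x : ℝ × ℝ}, ContDiffAt ℝ 1 k x → ContDiffAt ℝ 1 b x →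
      0 < k x → ContDiffAt ℝ 1 (fun x => rescaleAngle (k x) (b x)) x := by
    intro k b x hk hb hpos
    have := cos_sq_add_mul_sin_sq_pos hpos (b x)
    exact hb.add (ContDiffAt.arctan (ContDiffAt.div
      ((hk.sub contDiffAt_const).mul (hb.sin.mul hb.cos))
      ((hb.cos.pow 2).add (hk.mul (hb.sin.pow 2))) this.ne'))
  have hk1 : ContDiffAt ℝ 1 (fun x : ℝ × ℝ => √(lam - x.1)) (s, a) :=
    (contDiffAt_const.sub contDiffAt_fst).sqrt (by simp; linarith)
  have hl1 : ContDiffAt ℝ 1 (fun x : ℝ × ℝ => √(nu - x.1)) (s, a) :=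
    (contDiffAt_const.sub contDiffAt_fst).sqrt (by simp; linarith)
  exact hre (contDiffAt_const.div hk1 hk.ne')
    (hk1.mul ((hre hl1 contDiffAt_snd hl).div hl1 hl.ne')) hi

theorem monotoneOn_transportAngle {lam nu a : ℝ} (hlam : nu < lam) (ha : 0 ≤ a) :
    MonotoneOn (fun s => transportAngle lam nu s a) (Iio nu) := by
  have h := fun s (hs : s ∈ Iio nu) => exists_hasDerivAt_transportAngle hlam hs a
  refine monotoneOn_of_deriv_nonneg (convex_Iio nu)
    (fun s hs => (h s hs).choose_spec.1.continuousAt.continuousWithinAt)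
    (fun s hs => ?_) fun s hs => ?_
  · rw [interior_Iio] at hs
    exact (h s hs).choose_spec.1.differentiableAt.differentiableWithinAt
  · rw [interior_Iio] at hs
    obtain ⟨d, hd, h0, -⟩ := h s hs
    rw [hd.deriv]
    exact h0 ha

/-- If `f` vanishes at `a` or below, and near every point `x` it lies to the right of `x` below a
function touching it at `x` with derivative at most `L * |f x|`, then `f ≤ 0`, and `f` stays
negative once it is. -/
theorem nonpos_and_neg_of_deriv_majorant_le {f : ℝ → ℝ} {a b L : ℝ}
    (hf : ContinuousOn f (Icc a b)) (ha : f a ≤ 0)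
    (bound : ∀ x ∈ Ico a b, ∃ (g : ℝ → ℝ) (d : ℝ), HasDerivAt g d x ∧ g x = f x ∧
      (∀ᶠ z in 𝓝[>] x, f z ≤ g z) ∧ d ≤ L * |f x|) :
    (∀ x ∈ Icc a b, f x ≤ 0) ∧ ∀ c ∈ Icc a b, f c < 0 → ∀ x ∈ Icc c b, f x < 0 := by
  choose! g d hg hgx hfg hd using bound
  have hslope : ∀ x ∈ Ico a b, ∀ r, d x < r → ∃ᶠ z in 𝓝[>] x, slope f x z < r := by
    intro x hx r hr
    have h1 : ∀ᶠ z in 𝓝[>] x, slope (g x) x z < r :=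
      ((hasDerivAt_iff_tendsto_slope.1 (hg x hx)).mono_left
        (nhdsWithin_mono x fun z (hz : x < z) => hz.ne')).eventually_lt_const hr
    refine (h1.and ((hfg x hx).and self_mem_nhdsWithin)).frequently.mono ?_
    rintro z ⟨hz1, hz2, hz3 : x < z⟩
    refine lt_of_le_of_lt ?_ hz1
    rw [slope_def_field, slope_def_field, hgx x hx]
    have : 0 < z - x := sub_pos.2 hz3
    gcongr
  have hexp : ∀ C K c x : ℝ, HasDerivAt (fun x => C * exp (K * (x - c)))
      (C * (exp (K * (x - c)) * K)) x := fun C K c x => by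
    simpa using ((((hasDerivAt_id x).sub_const c).const_mul K).exp).const_mul C
  constructor
  · intro x hx
    have hx' : ∀ ε > 0, f x ≤ ε * exp ((L + 1) * (x - a)) := by
      intro ε hε
      refine image_le_of_liminf_slope_right_lt_deriv_boundary hf hslope (by simp; linarith)
        (hexp ε (L + 1) a) ?_ hx
      intro y hy hfy
      have h1 := hd y hy
      have hp : 0 < ε * exp ((L + 1) * (y - a)) := by positivity
      rw [hfy, abs_of_pos hp] at h1
      nlinarith
    by_contra! hpos
    have := hx' (f x / 2 / exp ((L + 1) * (x - a))) (by positivity)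
    rw [div_mul_cancel₀ _ (exp_pos _).ne'] at this
    linarith
  · intro c hc hfc x hx
    have hsub : Icc c b ⊆ Icc a b := Icc_subset_Icc_left hc.1
    have hsub' : Ico c b ⊆ Ico a b := Ico_subset_Ico_left hc.1
    have := image_le_of_liminf_slope_right_lt_deriv_boundary (hf.mono hsub)
      (fun y hy => hslope y (hsub' hy)) (B := fun x => f c * exp (-(L + 1) * (x - c)))
      (by simp) (hexp (f c) (-(L + 1)) c) ?_ hx
    · exact this.trans_lt (mul_neg_of_neg_of_pos hfc (exp_pos _))
    intro y hy hfy
    have h1 := hd y (hsub' hy)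
    have hp : f c * exp (-(L + 1) * (y - c)) < 0 := mul_neg_of_neg_of_pos hfc (exp_pos _)
    rw [hfy, abs_of_neg hp] at h1
    nlinarith

/-- `φ` is the Prüfer angle on `[0, b]` of the solution of `y'' = (q - lam) y` with `y 0 = 0`. -/
def IsPrueferAngle (q : ℝ → ℝ) (b lam : ℝ) (φ : ℝ → ℝ) : Prop :=
  φ 0 = 0 ∧ ∀ x ∈ Icc 0 b, HasDerivAt φ (prueferField (lam - q x) (φ x)) x

theorem exists_bound_abs_sub_one {q : ℝ → ℝ} {b : ℝ} (hq : ContinuousOn q (Icc 0 b)) (lam : ℝ) :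
    ∃ L, 0 ≤ L ∧ ∀ x ∈ Icc 0 b, |lam - q x - 1| ≤ L := by
  obtain ⟨C, hC⟩ := isCompact_Icc.exists_bound_of_continuousOn
    ((continuousOn_const (c := lam)).sub hq |>.sub (continuousOn_const (c := (1 : ℝ))))
  exact ⟨|C|, abs_nonneg C, fun x hx => (hC x hx).trans (le_abs_self C)⟩

theorem prueferField_of_sin_eq_zero {Λ a : ℝ} (h : sin a = 0) : prueferField Λ a = 1 := by
  have := sin_sq_add_cos_sq a
  rw [prueferField, h]
  rw [h] at this
  linarith

namespace IsPrueferAngle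

variable {q φ ψ : ℝ → ℝ} {b lam nu : ℝ}

theorem mono {c : ℝ} (h : IsPrueferAngle q b lam φ) (hc : c ≤ b) : IsPrueferAngle q c lam φ :=
  ⟨h.1, fun x hx => h.2 x ⟨hx.1, hx.2.trans hc⟩⟩

theorem continuousOn (h : IsPrueferAngle q b lam φ) : ContinuousOn φ (Icc 0 b) :=
  fun x hx => (h.2 x hx).continuousAt.continuousWithinAt

theorem pos (hq : ContinuousOn q (Icc 0 b)) (h : IsPrueferAngle q b lam φ) {x : ℝ}
    (hx : x ∈ Ioc 0 b) : 0 < φ x := by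
  obtain ⟨L, hL0, hL⟩ := exists_bound_abs_sub_one hq lam
  obtain ⟨h1, h2⟩ := nonpos_and_neg_of_deriv_majorant_le (f := fun x => -φ x) (L := L)
    h.continuousOn.neg (by simp [h.1]) (fun x hx => ⟨_, _, (h.2 x (Ico_subset_Icc_self hx)).neg,
      rfl, Eventually.of_forall fun _ => le_rfl, by
        have h3 := abs_prueferField_sub_le (lam - q x) (φ x) 0
        rw [prueferField_of_sin_eq_zero sin_zero, sub_zero] at h3
        have h4 := hL x (Ico_subset_Icc_self hx)
        rw [abs_neg]
        have h5 := neg_abs_le (prueferField (lam - q x) (φ x) - 1)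
        nlinarith [abs_nonneg (φ x)]⟩)
  by_contra! hneg
  have hx2 : x / 2 ∈ Ioo 0 x := ⟨by linarith [hx.1], by linarith [hx.1]⟩
  have hzero : φ =ᶠ[𝓝 (x / 2)] fun _ => 0 := by
    filter_upwards [Ioo_mem_nhds hx2.1 hx2.2] with c hc
    have hc' : c ∈ Icc 0 b := ⟨hc.1.le, hc.2.le.trans hx.2⟩
    have h3 := h1 c hc'
    by_contra hne
    have := h2 c hc' (lt_of_le_of_ne h3 (by simpa using hne)) x ⟨hc.2.le, hx.2⟩
    linarith
  have hd := h.2 (x / 2) ⟨hx2.1.le, hx2.2.le.trans hx.2⟩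
  have := hd.unique ((hasDerivAt_const (x / 2) (0 : ℝ)).congr_of_eventuallyEq hzero)
  rw [hzero.eq_of_nhds, prueferField_of_sin_eq_zero sin_zero] at this
  exact one_ne_zero this

theorem nonneg (hq : ContinuousOn q (Icc 0 b)) (h : IsPrueferAngle q b lam φ) {x : ℝ}
    (hx : x ∈ Icc 0 b) : 0 ≤ φ x := by
  rcases hx.1.eq_or_lt with rfl | h0
  · exact h.1.ge
  · exact (h.pos hq ⟨h0, hx.2⟩).le

theorem exists_sin_ne_zero (h : IsPrueferAngle q b lam φ) {x : ℝ} (hx : x ∈ Ioc 0 b) :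
    ∃ c ∈ Ioo 0 x, sin (φ c) ≠ 0 := by
  by_contra! hsin
  have hx2 : x / 2 ∈ Ioo 0 x := ⟨by linarith [hx.1], by linarith [hx.1]⟩
  have hd := (h.2 (x / 2) ⟨hx2.1.le, hx2.2.le.trans hx.2⟩).sin
  have hev : (fun y => sin (φ y)) =ᶠ[𝓝 (x / 2)] fun _ => 0 := by
    filter_upwards [Ioo_mem_nhds hx2.1 hx2.2] with y hy using hsin y hy
  have h3 := hd.unique ((hasDerivAt_const (x / 2) (0 : ℝ)).congr_of_eventuallyEq hev)
  rw [prueferField_of_sin_eq_zero (hsin _ hx2), mul_one] at h3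
  have h4 := sin_sq_add_cos_sq (φ (x / 2))
  rw [h3, hsin _ hx2] at h4
  norm_num at h4

theorem le_and_lt_of_le (hq : ContinuousOn q (Icc 0 b)) (h : IsPrueferAngle q b lam φ)
    (h' : IsPrueferAngle q b nu ψ) (hle : lam ≤ nu) :
    (∀ x ∈ Icc 0 b, φ x ≤ ψ x) ∧ (lam < nu → ∀ x ∈ Ioc 0 b, φ x < ψ x) := by
  obtain ⟨L, hL0, hL⟩ := exists_bound_abs_sub_one hq lam
  obtain ⟨h1, h2⟩ := nonpos_and_neg_of_deriv_majorant_le (f := fun x => φ x - ψ x) (L := L)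
    (h.continuousOn.sub h'.continuousOn) (by simp [h.1, h'.1]) (fun x hx =>
      ⟨_, _, (h.2 x (Ico_subset_Icc_self hx)).sub (h'.2 x (Ico_subset_Icc_self hx)),
      rfl, Eventually.of_forall fun _ => le_rfl, by
        have h3 := (le_abs_self _).trans (abs_prueferField_sub_le (lam - q x) (φ x) (ψ x))
        have h4 := mul_le_mul_of_nonneg_right (hL x (Ico_subset_Icc_self hx))
          (abs_nonneg (φ x - ψ x))
        have h5 : prueferField (nu - q x) (ψ x) =
          prueferField (lam - q x) (ψ x) + (nu - lam) * sin (ψ x) ^ 2 := by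
          rw [prueferField, prueferField]; ring
        have h6 : 0 ≤ (nu - lam) * sin (ψ x) ^ 2 := mul_nonneg (by linarith) (sq_nonneg _)
        linarith⟩)
  refine ⟨fun x hx => sub_nonpos.1 (h1 x hx), fun hlt x hx => ?_⟩
  by_contra! hneg
  have heq : ∀ c ∈ Ioo 0 x, φ c = ψ c := by
    intro c hc
    have hc' : c ∈ Icc 0 b := ⟨hc.1.le, hc.2.le.trans hx.2⟩
    by_contra hne
    have := h2 c hc' (lt_of_le_of_ne (h1 c hc') (sub_ne_zero.2 hne)) x ⟨hc.2.le, hx.2⟩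
    linarith
  obtain ⟨c, hc, hsin⟩ := h.exists_sin_ne_zero hx
  have hc' : c ∈ Icc 0 b := ⟨hc.1.le, hc.2.le.trans hx.2⟩
  have hev : φ =ᶠ[𝓝 c] ψ := by
    filter_upwards [Ioo_mem_nhds hc.1 hc.2] with y hy using heq y hy
  have h3 := (h.2 c hc').unique ((h'.2 c hc').congr_of_eventuallyEq hev)
  rw [← heq c hc, prueferField, prueferField] at h3
  have h4 : (nu - lam) * sin (φ c) ^ 2 = 0 := by linear_combination -h3
  exact mul_ne_zero (sub_ne_zero.2 hlt.ne') (pow_ne_zero 2 hsin) h4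

theorem sub_le_mul_exp {L : ℝ} (hq : ContinuousOn q (Icc 0 b))
    (h : IsPrueferAngle q b lam φ) (h' : IsPrueferAngle q b nu ψ) (hle : lam ≤ nu)
    (hL : ∀ x ∈ Icc 0 b, |lam - q x - 1| ≤ L) {x : ℝ} (hx : x ∈ Icc 0 b) :
    ψ x - φ x ≤ (nu - lam) * exp ((L + 1) * x) := by
  have hexp : ∀ x : ℝ, HasDerivAt (fun x => (nu - lam) * exp ((L + 1) * x))
      ((nu - lam) * (exp ((L + 1) * x) * (L + 1))) x := fun x => by
    simpa using (((hasDerivAt_id x).const_mul (L + 1)).exp).const_mul (nu - lam)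
  have hL0 : 0 ≤ L := (abs_nonneg _).trans (hL x hx)
  have key := (nonpos_and_neg_of_deriv_majorant_le
    (f := fun x => ψ x - φ x - (nu - lam) * exp ((L + 1) * x)) (L := L) (a := 0) (b := b)
    ((h'.continuousOn.sub h.continuousOn).sub
      (fun x _ => (hexp x).continuousAt.continuousWithinAt)) (by simp [h.1, h'.1, hle])
    (fun x hx => ⟨_, _, ((h'.2 x (Ico_subset_Icc_self hx)).sub
      (h.2 x (Ico_subset_Icc_self hx))).sub (hexp x),
      rfl, Eventually.of_forall fun _ => le_rfl, ?_⟩)).1 x hx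
  · linarith
  have hx' := Ico_subset_Icc_self hx
  have h3 := (le_abs_self _).trans (abs_prueferField_sub_le (lam - q x) (ψ x) (φ x))
  have h0 : 0 ≤ ψ x - φ x := sub_nonneg.2 ((le_and_lt_of_le hq h h' hle).1 x hx')
  have h4 := mul_le_mul_of_nonneg_right (hL x hx') (abs_nonneg (ψ x - φ x))
  rw [abs_of_nonneg h0] at h3 h4
  have h5 : prueferField (nu - q x) (ψ x) =
      prueferField (lam - q x) (ψ x) + (nu - lam) * sin (ψ x) ^ 2 := by
    rw [prueferField, prueferField]; ring
  have h6 : (nu - lam) * sin (ψ x) ^ 2 ≤ (nu - lam) * 1 :=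
    mul_le_mul_of_nonneg_left (sin_sq_le_one _) (by linarith)
  have h7 : (nu - lam) * 1 ≤ (nu - lam) * exp ((L + 1) * x) :=
    mul_le_mul_of_nonneg_left (one_le_exp (mul_nonneg (by linarith) hx.1)) (by linarith)
  have h8 := mul_le_mul_of_nonneg_left
    (le_abs_self (ψ x - φ x - (nu - lam) * exp ((L + 1) * x))) hL0
  nlinarith

/-- Comparison of the Prüfer angles for two spectral parameters, for an increasing potential. -/
theorem le_transportAngle (hq : ContinuousOn q (Icc 0 b)) (hmono : MonotoneOn q (Icc 0 b))
    (hqnu : ∀ x ∈ Icc 0 b, q x < nu) (hlt : nu < lam)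
    (h : IsPrueferAngle q b lam φ) (h' : IsPrueferAngle q b nu ψ) :
    (∀ x ∈ Icc 0 b, φ x ≤ transportAngle lam nu (q x) (ψ x)) ∧
    (φ b = transportAngle lam nu (q b) (ψ b) → ∀ x ∈ Icc 0 b, q x = q b) := by
  obtain ⟨L, hL0, hL⟩ := exists_bound_abs_sub_one hq lam
  have hcont : ContinuousOn (fun x => transportAngle lam nu (q x) (ψ x)) (Icc 0 b) := by
    intro x hx
    exact ContinuousAt.comp_continuousWithinAt (f := fun x => (q x, ψ x))
      (contDiffAt_transportAngle ((hqnu x hx).trans hlt) (hqnu x hx) (ψ x)).continuousAt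
      ((hq x hx).prodMk (h'.continuousOn x hx))
  have hfrozen : ∀ x ∈ Icc 0 b, HasDerivAt (fun z => φ z - transportAngle lam nu (q x) (ψ z))
      (prueferField (lam - q x) (φ x) -
        prueferField (lam - q x) (transportAngle lam nu (q x) (ψ x))) x := fun x hx =>
    (h.2 x hx).sub (hasDerivAt_transportAngle_comp ((hqnu x hx).trans hlt) (hqnu x hx) (h'.2 x hx))
  obtain ⟨h1, h2⟩ := nonpos_and_neg_of_deriv_majorant_le (a := 0) (b := b)
    (f := fun x => φ x - transportAngle lam nu (q x) (ψ x)) (L := L)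
    (h.continuousOn.sub hcont) (by simp [h.1, h'.1, transportAngle_zero]) (fun x hx => by
      have hx' := Ico_subset_Icc_self hx
      refine ⟨_, _, hfrozen x hx', rfl, ?_, ?_⟩
      · filter_upwards [Icc_mem_nhdsGT_of_mem hx, self_mem_nhdsWithin] with z hz hxz
        exact sub_le_sub_left (monotoneOn_transportAngle hlt (h'.nonneg hq hz)
          (hqnu x hx') (hqnu z hz) (hmono hx' hz (le_of_lt hxz))) _
      · exact ((le_abs_self _).trans (abs_prueferField_sub_le _ _ _)).trans
          (mul_le_mul_of_nonneg_right (hL x hx') (abs_nonneg _)))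
  refine ⟨fun x hx => sub_nonpos.1 (h1 x hx), fun hb => ?_⟩
  have heq : ∀ x ∈ Icc 0 b, φ x = transportAngle lam nu (q x) (ψ x) := by
    intro x hx
    by_contra hne
    have := h2 x hx (lt_of_le_of_ne (h1 x hx) (sub_ne_zero.2 hne)) b ⟨hx.2, le_rfl⟩
    linarith
  have hIoc : EqOn q (fun _ => q b) (Ioc 0 b) := by
    intro y hy
    have hb' : b ∈ Icc 0 b := ⟨hy.1.le.trans hy.2, le_rfl⟩
    refine le_antisymm (hmono (Ioc_subset_Icc_self hy) hb' hy.2) ?_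
    have hsub : Icc y b ⊆ Icc 0 b := Icc_subset_Icc_left hy.1.le
    have key := (nonpos_and_neg_of_deriv_majorant_le (a := y) (b := b)
      (f := fun x => q x - q y) (L := 0) ((hq.mono hsub).sub continuousOn_const) (by simp)
      (fun x hx => ?_)).1 b ⟨hy.2, le_rfl⟩
    · exact sub_nonpos.1 key
    have hx' : x ∈ Icc 0 b := hsub (Ico_subset_Icc_self hx)
    have hx'' : x ∈ Ico 0 b := ⟨hx'.1, hx.2⟩
    have hlam : q x < lam := (hqnu x hx').trans hlt
    obtain ⟨d, hd, -, hd0⟩ := exists_hasDerivAt_transportAngle hlt (hqnu x hx') (ψ x)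
    have hdpos : 0 < d := hd0 (h'.pos hq ⟨hy.1.trans_le hx.1, hx'.2⟩)
    have hstrict := (contDiffAt_transportAngle hlam (hqnu x hx') (ψ x)).hasStrictFDerivAt
      one_ne_zero
    set T := fderiv ℝ (fun x : ℝ × ℝ => transportAngle lam nu x.1 x.2) (q x, ψ x)
    have hT : T (1, 0) = d :=
      (HasFDerivAt.comp_hasDerivAt (f := fun s => (s, ψ x)) (q x) hstrict.hasFDerivAt
        ((hasDerivAt_id (q x)).prodMk (hasDerivAt_const (q x) (ψ x)))).unique hd
    refine ⟨fun z => q x - q y + 2 / d * (φ z - transportAngle lam nu (q x) (ψ z)), _,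
      ((hfrozen x hx').const_mul (2 / d)).const_add (q x - q y), by simp [← heq x hx'], ?_,
      by simp [← heq x hx']⟩
    have hle : 𝓝[>] x ≤ 𝓝[Icc 0 b] x := nhdsWithin_le_iff.2 (Icc_mem_nhdsGT_of_mem hx'')
    have hqx : Tendsto q (𝓝[>] x) (𝓝 (q x)) := (hq x hx').mono_left hle
    have hψx : Tendsto ψ (𝓝[>] x) (𝓝 (ψ x)) := (h'.continuousOn x hx').mono_left hle
    have hlim : Tendsto (fun z => ((q z, ψ z), (q x, ψ z))) (𝓝[>] x)
        (𝓝 ((q x, ψ x), (q x, ψ x))) :=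
      (hqx.prodMk_nhds hψx).prodMk_nhds (tendsto_const_nhds.prodMk_nhds hψx)
    have hev := hlim.eventually (hstrict.isLittleO.def (half_pos hdpos))
    filter_upwards [hev, Icc_mem_nhdsGT_of_mem hx'', self_mem_nhdsWithin] with z hz hzb hxz
    have hqz : 0 ≤ q z - q x := sub_nonneg.2 (hmono hx' hzb (le_of_lt hxz))
    have hTz : T (q z - q x, 0) = (q z - q x) * d := by
      rw [← hT, ← smul_eq_mul, ← map_smul]
      simp
    simp only [Prod.mk_sub_mk, sub_self, hTz, ← heq z hzb] at hz
    have hn : ‖((q z - q x, 0) : ℝ × ℝ)‖ = q z - q x := by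
      rw [Prod.norm_mk, norm_zero, Real.norm_eq_abs, abs_of_nonneg hqz, max_eq_left hqz]
    rw [hn, Real.norm_eq_abs] at hz
    have h3 := (abs_le.1 hz).1
    have h4 : d / 2 * (q z - q x) ≤ φ z - transportAngle lam nu (q x) (ψ z) := by linarith
    have h5 : q z - q x ≤ 2 / d * (φ z - transportAngle lam nu (q x) (ψ z)) := by
      rw [div_mul_eq_mul_div, le_div_iff₀ hdpos]; linarith
    linarith
  intro x hx
  rcases (hx.1.trans hx.2).eq_or_lt with hb0 | hb0
  · rw [le_antisymm hx.2 (hb0 ▸ hx.1)]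
  · exact hIoc.of_subset_closure hq continuousOn_const Ioc_subset_Icc_self
      (by rw [closure_Ioc hb0.ne]) hx

end IsPrueferAngle

theorem exists_isPrueferAngle {q : ℝ → ℝ} (hq : ContinuousOn q (Icc 0 1)) (lam : ℝ) :
    ∃ φ, IsPrueferAngle q 1 lam φ := by
  set Q : ℝ → ℝ := fun x => q (projIcc 0 1 zero_le_one x) with hQ
  have hQc : Continuous Q := (continuousOn_iff_continuous_domRestrict.1 hq).comp continuous_projIcc
  have hQq : ∀ x ∈ Icc (0 : ℝ) 1, Q x = q x := fun x hx => by rw [hQ]; simp [projIcc_of_mem _ hx]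
  obtain ⟨L, hL0, hL⟩ := exists_bound_abs_sub_one hq lam
  have hLQ : ∀ x, |lam - Q x - 1| ≤ L := fun x => hL _ (projIcc 0 1 zero_le_one x).2
  have hPL : IsPicardLindelof (fun t a => prueferField (lam - Q t) a) (tmin := -1) (tmax := 2)
      ⟨0, by norm_num⟩ 0 (2 * (⟨L, hL0⟩ + 1)) 0 (⟨L, hL0⟩ + 1) ⟨L, hL0⟩ := by
    constructor
    · intro t _
      refine (LipschitzWith.of_dist_le_mul fun a b => ?_).lipschitzOnWith
      rw [Real.dist_eq, Real.dist_eq]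
      exact (abs_prueferField_sub_le _ _ _).trans
        (mul_le_mul_of_nonneg_right (hLQ t) (abs_nonneg _))
    · intro a _
      unfold prueferField
      fun_prop
    · intro t _ a _
      have : prueferField (lam - Q t) a = 1 + (lam - Q t - 1) * sin a ^ 2 := by
        rw [prueferField, cos_sq']; ring
      rw [Real.norm_eq_abs, this]
      refine (abs_add_le _ _).trans ?_
      rw [abs_one, abs_mul, abs_of_nonneg (sq_nonneg (sin a))]
      have h1 := hLQ t
      have h2 := sin_sq_le_one a
      have h3 := mul_le_mul h1 h2 (sq_nonneg _) hL0
      change _ ≤ L + 1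
      linarith
    · norm_num
      change (L + 1) * 2 ≤ 2 * (L + 1)
      linarith
  obtain ⟨φ, h0, hφ⟩ := hPL.exists_eq_forall_mem_Icc_hasDerivWithinAt₀
  refine ⟨φ, h0, fun x hx => ?_⟩
  rw [← hQq x hx]
  exact (hφ x ⟨by linarith [hx.1], by linarith [hx.2]⟩).hasDerivAt
    (Icc_mem_nhds (by linarith [hx.1]) (by linarith [hx.2]))

namespace IsPrueferAngle

variable {q φ ψ : ℝ → ℝ} {b lam nu : ℝ}

theorem isDirichletEigenvalue (hq : ContinuousOn q (Icc 0 1)) (h : IsPrueferAngle q 1 lam φ)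
    (hsin : sin (φ 1) = 0) : IsDirichletEigenvalue q 0 1 lam := by
  set G : ℝ → ℝ := fun x => (1 - (lam - q x)) * (sin (φ x) * cos (φ x))
  have hGc : ContinuousOn G (Icc 0 1) := by
    have := h.continuousOn
    fun_prop
  have hEc : Continuous (fun x : ℝ => G (projIcc (0 : ℝ) 1 zero_le_one x)) :=
    hGc.comp_continuous (continuous_subtype_val.comp continuous_projIcc) fun x =>
      (projIcc (0 : ℝ) 1 zero_le_one x).2
  set r : ℝ → ℝ := fun x => exp (∫ t in (0 : ℝ)..x, G (projIcc (0 : ℝ) 1 zero_le_one t))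
  have hr : ∀ x ∈ Icc (0 : ℝ) 1, HasDerivAt r (r x * G x) x := by
    intro x hx
    have := (hEc.integral_hasStrictDerivAt 0 x).hasDerivAt.exp
    simpa only [projIcc_of_mem _ hx] using this
  refine ⟨fun x => r x * sin (φ x), fun x => r x * cos (φ x), fun x hx => ?_, fun x hx => ?_,
    ?_, by simp [h.1], by simp [hsin]⟩
  · refine ((hr x hx).mul (h.2 x hx).sin).congr_deriv ?_
    simp only [G, prueferField]
    linear_combination r x * cos (φ x) * sin_sq_add_cos_sq (φ x)
  · refine ((hr x hx).mul (h.2 x hx).cos).congr_deriv ?_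
    simp only [G, prueferField]
    linear_combination -(r x * sin (φ x) * (lam - q x)) * sin_sq_add_cos_sq (φ x)
  · obtain ⟨c, hc, hne⟩ := h.exists_sin_ne_zero (x := 1) (by simp)
    exact ⟨c, Ioo_subset_Icc_self hc, mul_ne_zero (exp_pos _).ne' hne⟩

theorem sin_eq_zero_of_isDirichletEigenvalue (hq : ContinuousOn q (Icc 0 1))
    (h : IsPrueferAngle q 1 lam φ) (hlam : IsDirichletEigenvalue q 0 1 lam) :
    sin (φ 1) = 0 := by
  obtain ⟨y, y', hy, hy', ⟨c, hc, hyc⟩, hy0, hy1⟩ := hlam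
  obtain ⟨L, hL0, hL⟩ := exists_bound_abs_sub_one hq lam
  have h1mem : (1 : ℝ) ∈ Icc (0 : ℝ) 1 := by simp
  have hw : ∀ x ∈ Icc (0 : ℝ) 1, HasDerivAt
      (fun x => (y x * cos (φ x) - y' x * sin (φ x)) ^ 2)
      (2 * (lam - q x - 1) * (sin (φ x) * cos (φ x)) *
        (y x * cos (φ x) - y' x * sin (φ x)) ^ 2) x := by
    intro x hx
    refine ((((hy x hx).mul (h.2 x hx).cos).sub ((hy' x hx).mul (h.2 x hx).sin)).pow 2).congr_deriv
      ?_
    simp only [Pi.sub_apply, Pi.mul_apply, prueferField]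
    linear_combination -2 * (y x * cos (φ x) - y' x * sin (φ x)) *
      (y' x * cos (φ x) + y x * sin (φ x) * (lam - q x)) * sin_sq_add_cos_sq (φ x)
  have hw1 := (nonpos_and_neg_of_deriv_majorant_le (a := 0) (b := 1) (L := 2 * L)
    (f := fun x => (y x * cos (φ x) - y' x * sin (φ x)) ^ 2)
    (fun x hx => (hw x hx).continuousAt.continuousWithinAt) (by simp [hy0, h.1])
    (fun x hx => ⟨_, _, hw x (Ico_subset_Icc_self hx), rfl,
      Eventually.of_forall fun _ => le_rfl, by
        have h3 := hL x (Ico_subset_Icc_self hx)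
        rw [abs_of_nonneg (sq_nonneg _)]
        refine mul_le_mul_of_nonneg_right ?_ (sq_nonneg _)
        refine (le_abs_self _).trans ?_
        rw [abs_mul, abs_mul, abs_mul, abs_two]
        have h4 := mul_le_mul (abs_sin_le_one (φ x)) (abs_cos_le_one (φ x)) (abs_nonneg _)
          zero_le_one
        have h5 := mul_le_mul h3 h4 (by positivity) hL0
        linarith⟩)).1 1 h1mem
  have hprod : y' 1 * sin (φ 1) = 0 := by
    have := pow_eq_zero_iff two_ne_zero |>.1 (le_antisymm hw1 (sq_nonneg _))
    rw [hy1] at this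
    linarith
  refine (mul_eq_zero.1 hprod).resolve_left fun hy'1 => ?_
  have hmem : ∀ x ∈ Icc (0 : ℝ) 1, 1 - x ∈ Icc (0 : ℝ) 1 := fun x hx =>
    ⟨by linarith [hx.2], by linarith [hx.1]⟩
  have hE : ∀ x ∈ Icc (0 : ℝ) 1, HasDerivAt (fun x => y (1 - x) ^ 2 + y' (1 - x) ^ 2)
      (2 * (lam - q (1 - x) - 1) * (y (1 - x) * y' (1 - x))) x := by
    intro x hx
    have hsub : HasDerivAt (fun x : ℝ => 1 - x) (-1) x := by
      simpa using (hasDerivAt_id x).const_sub 1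
    have e1 := (hy _ (hmem x hx)).comp x hsub
    have e2 := (hy' _ (hmem x hx)).comp x hsub
    refine ((e1.pow 2).add (e2.pow 2)).congr_deriv ?_
    simp
    ring
  have hE1 := (nonpos_and_neg_of_deriv_majorant_le (a := 0) (b := 1) (L := L)
    (f := fun x => y (1 - x) ^ 2 + y' (1 - x) ^ 2)
    (fun x hx => (hE x hx).continuousAt.continuousWithinAt) (by simp [hy1, hy'1])
    (fun x hx => ⟨_, _, hE x (Ico_subset_Icc_self hx), rfl,
      Eventually.of_forall fun _ => le_rfl, by
        have h3 := hL _ (hmem x (Ico_subset_Icc_self hx))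
        rw [abs_of_nonneg (by positivity)]
        refine (le_abs_self _).trans ?_
        rw [abs_mul, abs_mul, abs_two, abs_mul]
        have h4 := two_mul_le_add_sq |y (1 - x)| |y' (1 - x)|
        rw [sq_abs, sq_abs] at h4
        have h5 := mul_le_mul h3 h4 (by positivity) hL0
        linarith⟩)).1 (1 - c) (hmem c hc)
  simp only [sub_sub_cancel] at hE1
  have := sq_nonneg (y' c)
  have := pow_pos (abs_pos.2 hyc) 2
  rw [sq_abs] at this
  linarith

theorem lt_pi_of_lt_neg_one (h : IsPrueferAngle q 1 lam φ)
    (hq : ∀ x ∈ Icc (0 : ℝ) 1, lam - q x < -1) : φ 1 < π := by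
  have hB := image_le_of_deriv_right_lt_deriv_boundary h.continuousOn
    (fun x hx => (h.2 x (Ico_subset_Icc_self hx)).hasDerivWithinAt)
    (B := fun _ => 3 * π / 4) (B' := fun _ => 0)
    (by rw [h.1]; positivity) (fun x => hasDerivAt_const x _)
    (fun x hx hφ => by
      have h1 : cos (2 * (3 * π / 4)) = 0 := by
        rw [show 2 * (3 * π / 4) = π / 2 + π by ring, cos_add_pi, cos_pi_div_two, neg_zero]
      rw [hφ, prueferField, sin_sq, cos_sq, h1]
      have := hq x (Ico_subset_Icc_self hx)
      linarith) (x := 1) (by simp)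
  have := pi_pos
  linarith

theorem hasDerivAt_rescaleAngle (h : IsPrueferAngle q b lam φ) {k : ℝ} (hk : 0 < k) {x : ℝ}
    (hx : x ∈ Icc 0 b) : HasDerivAt (fun x => rescaleAngle k (φ x))
      (k + k * ((lam - q x - k ^ 2) * sin (φ x) ^ 2 /
        (cos (φ x) ^ 2 + k ^ 2 * sin (φ x) ^ 2))) x := by
  refine (_root_.hasDerivAt_rescaleAngle (hasDerivAt_const x k) (h.2 x hx) hk).congr_deriv ?_
  have := cos_sq_add_mul_sin_sq_pos (pow_pos hk 2) (φ x)
  rw [prueferField]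
  field_simp
  ring

theorem le_rescaleAngle (h : IsPrueferAngle q 1 lam φ) {k : ℝ} (hk : 0 < k)
    (hq : ∀ x ∈ Icc (0 : ℝ) 1, k ^ 2 ≤ lam - q x) : k ≤ rescaleAngle k (φ 1) := by
  have hd := fun x (hx : x ∈ Icc (0 : ℝ) 1) =>
    ((hasDerivAt_id x).const_mul k).sub (h.hasDerivAt_rescaleAngle hk hx)
  have := (nonpos_and_neg_of_deriv_majorant_le (a := 0) (b := 1) (L := 0)
    (fun x hx => (hd x hx).continuousAt.continuousWithinAt)
    (by simp [h.1, rescaleAngle_zero])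
    (fun x hx => ⟨_, _, hd x (Ico_subset_Icc_self hx), rfl,
      Eventually.of_forall fun _ => le_rfl, by
        have h1 := cos_sq_add_mul_sin_sq_pos (pow_pos hk 2) (φ x)
        have h2 := hq x (Ico_subset_Icc_self hx)
        have : 0 ≤ k * ((lam - q x - k ^ 2) * sin (φ x) ^ 2 /
            (cos (φ x) ^ 2 + k ^ 2 * sin (φ x) ^ 2)) :=
          mul_nonneg hk.le (div_nonneg (mul_nonneg (by linarith) (sq_nonneg _)) h1.le)
        linarith⟩)).1 1 (by simp)
  simpa using this

theorem rescaleAngle_le (h : IsPrueferAngle q 1 lam φ) {k : ℝ} (hk : 0 < k)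
    (hq : ∀ x ∈ Icc (0 : ℝ) 1, lam - q x ≤ k ^ 2) : rescaleAngle k (φ 1) ≤ k := by
  have hd := fun x (hx : x ∈ Icc (0 : ℝ) 1) =>
    (h.hasDerivAt_rescaleAngle hk hx).sub ((hasDerivAt_id x).const_mul k)
  have := (nonpos_and_neg_of_deriv_majorant_le (a := 0) (b := 1) (L := 0)
    (fun x hx => (hd x hx).continuousAt.continuousWithinAt)
    (by simp [h.1, rescaleAngle_zero])
    (fun x hx => ⟨_, _, hd x (Ico_subset_Icc_self hx), rfl,
      Eventually.of_forall fun _ => le_rfl, by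
        have h1 := cos_sq_add_mul_sin_sq_pos (pow_pos hk 2) (φ x)
        have h2 := hq x (Ico_subset_Icc_self hx)
        have : k * ((lam - q x - k ^ 2) * sin (φ x) ^ 2 /
            (cos (φ x) ^ 2 + k ^ 2 * sin (φ x) ^ 2)) ≤ 0 :=
          mul_nonpos_of_nonneg_of_nonpos hk.le (div_nonpos_of_nonpos_of_nonneg
            (mul_nonpos_of_nonpos_of_nonneg (by linarith) (sq_nonneg _)) h1.le)
        linarith⟩)).1 1 (by simp)
  simpa using this

theorem reflect (h : IsPrueferAngle q 1 lam φ) {n : ℕ} (hn : φ 1 = n * π) :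
    IsPrueferAngle (fun x => q (1 - x)) 1 lam (fun x => n * π - φ (1 - x)) := by
  refine ⟨by simp [hn], fun x hx => ?_⟩
  have hsub : HasDerivAt (fun x : ℝ => 1 - x) (-1) x := by
    simpa using (hasDerivAt_id x).const_sub 1
  have hd := ((h.2 (1 - x) ⟨by linarith [hx.2], by linarith [hx.1]⟩).comp x hsub).const_sub (n * π)
  refine hd.congr_deriv ?_
  have h1 : sin (n * π - φ (1 - x)) ^ 2 = sin (φ (1 - x)) ^ 2 := by
    rw [sin_sq_eq_half_sub, sin_sq_eq_half_sub,
      show 2 * (n * π - φ (1 - x)) = n * (2 * π) - 2 * φ (1 - x) by ring, cos_nat_mul_two_pi_sub]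
  rw [prueferField, prueferField, cos_sq', cos_sq', h1]
  ring

end IsPrueferAngle

theorem exists_isPrueferAngle_eq_mul_pi {q : ℝ → ℝ} (hq : ContinuousOn q (Icc 0 1)) {n : ℕ}
    (hn : 0 < n) : ∃ lam φ, IsPrueferAngle q 1 lam φ ∧ φ 1 = n * π := by
  choose Φ hΦ using exists_isPrueferAngle hq
  obtain ⟨C, hC⟩ := isCompact_Icc.exists_bound_of_continuousOn hq
  have hC0 : 0 ≤ C := (norm_nonneg _).trans (hC 0 (by simp))
  have hCq : ∀ x ∈ Icc (0 : ℝ) 1, -C ≤ q x ∧ q x ≤ C := fun x hx => abs_le.1 (hC x hx)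
  set k : ℝ := (n + 1) * π
  have hk : 0 < k := by positivity
  set lo : ℝ := -C - 2
  set hi : ℝ := C + k ^ 2
  have hle : lo ≤ hi := by simp only [lo, hi]; nlinarith
  have hmono : Monotone fun lam => Φ lam 1 := fun lam nu h =>
    ((hΦ lam).le_and_lt_of_le hq (hΦ nu) h).1 1 (by simp)
  have hcont : ContinuousOn (fun lam => Φ lam 1) (Icc lo hi) := by
    set L : ℝ := C + k ^ 2 + C + 2 + 1
    have hL : ∀ lam ∈ Icc lo hi, ∀ x ∈ Icc (0 : ℝ) 1, |lam - q x - 1| ≤ L := by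
      intro lam hlam x hx
      have h1 := hCq x hx
      have h2 := hlam.1
      have h3 := hlam.2
      simp only [lo, hi] at h2 h3
      rw [abs_le]
      constructor <;> simp only [L] <;> nlinarith
    have hLip : ∀ lam ∈ Icc lo hi, ∀ nu ∈ Icc lo hi, lam ≤ nu →
        |Φ lam 1 - Φ nu 1| ≤ exp (L + 1) * |lam - nu| := by
      intro lam hlam nu hnu hl
      have h1 := (hΦ lam).sub_le_mul_exp hq (hΦ nu) hl (hL lam hlam) (x := 1) (by simp)
      have h2 : Φ lam 1 ≤ Φ nu 1 := hmono hl
      rw [abs_sub_comm, abs_of_nonneg (sub_nonneg.2 h2), abs_sub_comm,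
        abs_of_nonneg (sub_nonneg.2 hl)]
      rw [mul_one] at h1
      linarith
    refine (LipschitzOnWith.of_dist_le_mul (K := ⟨exp (L + 1), (exp_pos _).le⟩)
      fun lam hlam nu hnu => ?_).continuousOn
    rw [Real.dist_eq, Real.dist_eq]
    rcases le_total lam nu with hl | hl
    · exact hLip lam hlam nu hnu hl
    · rw [abs_sub_comm, abs_sub_comm lam]
      exact hLip nu hnu lam hlam hl
  have hn1 : (1 : ℝ) ≤ n := by exact_mod_cast hn
  have hlo : Φ lo 1 ≤ n * π := by
    have := (hΦ lo).lt_pi_of_lt_neg_one fun x hx => by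
      have := hCq x hx
      simp only [lo]
      linarith
    nlinarith [pi_pos]
  have hhi : n * π ≤ Φ hi 1 := by
    have h1 := (hΦ hi).le_rescaleAngle hk fun x hx => by
      have := hCq x hx
      simp only [hi]
      linarith
    have h2 := (abs_lt.1 (abs_rescaleAngle_sub_lt k (Φ hi 1))).2
    simp only [k] at h1 h2
    linarith [pi_pos]
  obtain ⟨lam, -, h⟩ := intermediate_value_Icc hle hcont ⟨hlo, hhi⟩
  exact ⟨lam, Φ lam, hΦ lam, h⟩

theorem IsPrueferAngle.eq_mul_pi_of_enumeration {q : ℝ → ℝ} (hq : ContinuousOn q (Icc 0 1))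
    {μ : ℕ+ → ℝ} (hμ_mono : StrictMono μ) (hμ_eig : ∀ n : ℕ+, IsDirichletEigenvalue q 0 1 (μ n))
    (hμ_all : ∀ lam : ℝ, IsDirichletEigenvalue q 0 1 lam → ∃ n : ℕ+, μ n = lam)
    {n : ℕ+} {φ : ℝ → ℝ} (h : IsPrueferAngle q 1 (μ n) φ) : φ 1 = n * π := by
  have hex : ∀ n : ℕ+, ∃ k : ℕ+, ∀ φ, IsPrueferAngle q 1 (μ n) φ → φ 1 = k * π := by
    intro n
    obtain ⟨ψ, hψ⟩ := exists_isPrueferAngle hq (μ n)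
    obtain ⟨k, hk⟩ := sin_eq_zero_iff.1 (hψ.sin_eq_zero_of_isDirichletEigenvalue hq (hμ_eig n))
    have hpos : 0 < ψ 1 := hψ.pos hq (by simp)
    rw [← hk] at hpos
    have hk0 : 0 < k := by exact_mod_cast pos_of_mul_pos_left hpos pi_pos.le
    lift k to ℕ using hk0.le
    refine ⟨⟨k, by exact_mod_cast hk0⟩, fun φ hφ => ?_⟩
    have : φ 1 = ψ 1 := le_antisymm ((hφ.le_and_lt_of_le hq hψ le_rfl).1 1 (by simp))
      ((hψ.le_and_lt_of_le hq hφ le_rfl).1 1 (by simp))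
    rw [this, ← hk]
    simp
  choose k hk using hex
  have hk_mono : StrictMono k := by
    intro n m hnm
    obtain ⟨φ, hφ⟩ := exists_isPrueferAngle hq (μ n)
    obtain ⟨ψ, hψ⟩ := exists_isPrueferAngle hq (μ m)
    have := (hφ.le_and_lt_of_le hq hψ (hμ_mono hnm).le).2 (hμ_mono hnm) 1 (by simp)
    rw [hk n φ hφ, hk m ψ hψ] at this
    exact_mod_cast lt_of_mul_lt_mul_right this pi_pos.le
  have hk_surj : Function.Surjective k := by
    intro m
    obtain ⟨lam, φ, hφ, hm⟩ := exists_isPrueferAngle_eq_mul_pi hq m.pos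
    obtain ⟨n, rfl⟩ := hμ_all lam (hφ.isDirichletEigenvalue hq (by rw [hm, sin_nat_mul_pi]))
    refine ⟨n, ?_⟩
    rw [hk n φ hφ] at hm
    exact_mod_cast mul_right_cancel₀ pi_pos.ne' hm
  have : k = id := (hk_mono.range_inj strictMono_id).1 (by rw [hk_surj.range_eq, range_id])
  rw [hk n φ h, this, id]

theorem dirichlet_eigenvalue_eq_of_potential_zero {q : ℝ → ℝ} (hq : ∀ x ∈ Icc (0 : ℝ) 1, q x = 0)
    {μ : ℕ+ → ℝ} (hμ_mono : StrictMono μ) (hμ_eig : ∀ n : ℕ+, IsDirichletEigenvalue q 0 1 (μ n))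
    (hμ_all : ∀ lam : ℝ, IsDirichletEigenvalue q 0 1 lam → ∃ n : ℕ+, μ n = lam) (n : ℕ+) :
    μ n = (n * π) ^ 2 := by
  have hqc : ContinuousOn q (Icc 0 1) := continuousOn_const.congr hq
  have hnpos : (0 : ℝ) < n := by exact_mod_cast n.pos
  have hk : 0 < n * π := by positivity
  obtain ⟨φ, hφ⟩ := exists_isPrueferAngle hqc (μ n)
  obtain ⟨ψ, hψ⟩ := exists_isPrueferAngle hqc ((n * π) ^ 2)
  have h1 := hφ.eq_mul_pi_of_enumeration hqc hμ_mono hμ_eig hμ_all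
  have h2 : rescaleAngle (n * π) (ψ 1) = n * π :=
    le_antisymm (hψ.rescaleAngle_le hk fun x hx => by simp [hq x hx])
      (hψ.le_rescaleAngle hk fun x hx => by simp [hq x hx])
  have h3 : ψ 1 = n * π := by
    have h4 : rescaleAngle (n * π) (n * π) = n * π := by
      simpa using rescaleAngle_int_mul_pi (n * π) n
    exact (strictMono_rescaleAngle hk).injective (h2.trans h4.symm)
  rcases lt_trichotomy (μ n) ((n * π) ^ 2) with h | h | h
  · have := (hφ.le_and_lt_of_le hqc hψ h.le).2 h 1 (by simp)
    linarith
  · exact h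
  · have := (hψ.le_and_lt_of_le hqc hφ h.le).2 h 1 (by simp)
    linarith

end

/-!
**Statement 3.**  Let `q : [0,1] → ℝ` be continuous, nonpositive and single-barrier,
and set `q₋ = min {q x : x ∈ [0,1]}`.  Let `λ₁ < λ₂ < ⋯` enumerate the eigenvalues of
the Dirichlet problem `−y'' + q y = λ y` on `[0,1]`, `y 0 = y 1 = 0`.  If for two
different indices `n ≠ m` with `λ_n > λ_m ≥ −2 q₋` the equality `λ_n / λ_m = n² / m²`
holds, then `q ≡ 0` on `[0,1]`; conversely, if `q ≡ 0` on `[0,1]` then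
`λ_n / λ_m = n² / m²` for all `n, m`.
-/
theorem dirichlet_eigenvalue_ratio_equality_iff_q_zero
    (q : ℝ → ℝ) (x₀ : ℝ) (hx₀ : x₀ ∈ Set.Icc (0 : ℝ) 1)
    (hq_cont : ContinuousOn q (Set.Icc 0 1))
    (hq_nonpos : ∀ x ∈ Set.Icc (0 : ℝ) 1, q x ≤ 0)
    (hq_inc : MonotoneOn q (Set.Icc 0 x₀))
    (hq_dec : AntitoneOn q (Set.Icc x₀ 1))
    (qmin : ℝ) (hqmin : IsLeast (q '' Set.Icc 0 1) qmin)
    -- `μ n` is the `n`-th Dirichlet eigenvalue: `μ` is the strictly increasing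
    -- enumeration of the whole spectrum
    (μ : ℕ+ → ℝ) (hμ_mono : StrictMono μ)
    (hμ_eig : ∀ n : ℕ+, IsDirichletEigenvalue q 0 1 (μ n))
    (hμ_all : ∀ lam : ℝ, IsDirichletEigenvalue q 0 1 lam → ∃ n : ℕ+, μ n = lam) :
    ((∃ n m : ℕ+, n ≠ m ∧ μ m < μ n ∧ -2 * qmin ≤ μ m ∧
        μ n / μ m = (n : ℝ) ^ 2 / (m : ℝ) ^ 2) →
      ∀ x ∈ Set.Icc (0 : ℝ) 1, q x = 0) ∧
    ((∀ x ∈ Set.Icc (0 : ℝ) 1, q x = 0) →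
      ∀ n m : ℕ+, μ n / μ m = (n : ℝ) ^ 2 / (m : ℝ) ^ 2) := by
  refine ⟨?_, fun hq n m => ?_⟩
  · rintro ⟨n, m, -, hlt, hge, hratio⟩
    obtain ⟨⟨z, hz, hqz⟩, hleast⟩ := hqmin
    have hmin : ∀ x ∈ Set.Icc (0 : ℝ) 1, qmin ≤ q x := fun x hx => hleast ⟨x, hx, rfl⟩
    rcases (hqz ▸ hq_nonpos z hz : qmin ≤ 0).eq_or_lt with h0 | h0
    · exact fun x hx => le_antisymm (hq_nonpos x hx) (h0 ▸ hmin x hx)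
    have hm0 : 0 < μ m := by linarith
    have hnm : m < n := hμ_mono.lt_iff_lt.1 hlt
    obtain ⟨φ, hφ⟩ := exists_isPrueferAngle hq_cont (μ n)
    obtain ⟨ψ, hψ⟩ := exists_isPrueferAngle hq_cont (μ m)
    have hφ1 := hφ.eq_mul_pi_of_enumeration hq_cont hμ_mono hμ_eig hμ_all
    have hψ1 := hψ.eq_mul_pi_of_enumeration hq_cont hμ_mono hμ_eig hμ_all
    have hqm : ∀ x ∈ Set.Icc (0 : ℝ) 1, q x < μ m := fun x hx => (hq_nonpos x hx).trans_lt hm0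
    have hx₀' : 1 - x₀ ≤ 1 := by linarith [hx₀.1]
    have hrefl : ∀ x ∈ Set.Icc (0 : ℝ) (1 - x₀), 1 - x ∈ Set.Icc x₀ 1 := fun x hx =>
      ⟨by linarith [hx.2], by linarith [hx.1]⟩
    have hsub : Set.Icc x₀ 1 ⊆ Set.Icc 0 1 := Set.Icc_subset_Icc_left hx₀.1
    obtain ⟨hleft, hleft_eq⟩ := IsPrueferAngle.le_transportAngle
      (hq_cont.mono (Set.Icc_subset_Icc_right hx₀.2)) hq_inc
      (fun x hx => hqm x ⟨hx.1, hx.2.trans hx₀.2⟩) hlt (hφ.mono hx₀.2) (hψ.mono hx₀.2)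
    obtain ⟨hright, hright_eq⟩ := IsPrueferAngle.le_transportAngle
      (q := fun x => q (1 - x)) (b := 1 - x₀)
      (hq_cont.comp (by fun_prop) fun x hx => hsub (hrefl x hx))
      (fun x hx y hy hxy => hq_dec (hrefl y hy) (hrefl x hx) (by linarith))
      (fun x hx => hqm _ (hsub (hrefl x hx))) hlt
      ((hφ.reflect hφ1).mono hx₀') ((hψ.reflect hψ1).mono hx₀')
    replace hleft := hleft x₀ ⟨hx₀.1, le_rfl⟩
    replace hright := hright (1 - x₀) ⟨by linarith [hx₀.2], le_rfl⟩
    simp only [sub_sub_cancel] at hright hright_eq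
    have hs0 := hq_nonpos x₀ hx₀
    have hsm := hqm x₀ hx₀
    set s := q x₀
    have hk : 0 < √(μ n - s) := Real.sqrt_pos.2 (by linarith)
    have hl : 0 < √(μ m - s) := Real.sqrt_pos.2 (by linarith)
    have hk2 : √(μ n - s) ^ 2 = μ n - s := Real.sq_sqrt (by linarith)
    have hl2 : √(μ m - s) ^ 2 = μ m - s := Real.sq_sqrt (by linarith)
    have hmono := strictMono_rescaleAngle hk
    have hleft' := hmono.monotone hleft
    have hright' := hmono.monotone hright
    rw [rescaleAngle_transportAngle (hsm.trans hlt)] at hleft' hright'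
    rw [rescaleAngle_nat_mul_pi_sub, rescaleAngle_nat_mul_pi_sub] at hright'
    have hleft_inj : rescaleAngle √(μ n - s) (φ x₀) = √(μ n - s) *
        (rescaleAngle √(μ m - s) (ψ x₀) / √(μ m - s)) → ∀ x ∈ Set.Icc 0 x₀, q x = s :=
      fun h => hleft_eq (hmono.injective (by rw [rescaleAngle_transportAngle (hsm.trans hlt), h]))
    have hright_inj : n * Real.pi - rescaleAngle √(μ n - s) (φ x₀) = √(μ n - s) *
        ((m * Real.pi - rescaleAngle √(μ m - s) (ψ x₀)) / √(μ m - s)) →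
        ∀ x ∈ Set.Icc 0 (1 - x₀), q (1 - x) = s :=
      fun h => hright_eq (hmono.injective (by
        rw [rescaleAngle_transportAngle (hsm.trans hlt), rescaleAngle_nat_mul_pi_sub,
          rescaleAngle_nat_mul_pi_sub, h]))
    set k := √(μ n - s)
    set l := √(μ m - s)
    set A := rescaleAngle k (φ x₀)
    set B := rescaleAngle l (ψ x₀)
    have hnpos : (0 : ℝ) < n := by exact_mod_cast n.pos
    have hmpos : (0 : ℝ) < m := by exact_mod_cast m.pos
    have hmn : (m : ℝ) < n := by exact_mod_cast hnm
    rw [div_eq_div_iff hm0.ne' (by positivity)] at hratio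
    rw [← mul_div_assoc, le_div_iff₀ hl] at hleft' hright'
    rw [← mul_div_assoc, eq_div_iff hl.ne'] at hleft_inj hright_inj
    have hsum : n * l ≤ m * k := by
      have : (n * l) * Real.pi ≤ (m * k) * Real.pi := by linarith
      exact le_of_mul_le_mul_right this Real.pi_pos
    have hsq : (n * l) ^ 2 ≤ (m * k) ^ 2 := pow_le_pow_left₀ (by positivity) hsum 2
    rw [mul_pow, mul_pow, hk2, hl2] at hsq
    have hs : s = 0 := by
      refine le_antisymm hs0 ?_
      have h1 : 0 < (n : ℝ) ^ 2 - (m : ℝ) ^ 2 := by nlinarith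
      have h2 : 0 ≤ ((n : ℝ) ^ 2 - (m : ℝ) ^ 2) * s := by linarith
      exact nonneg_of_mul_nonneg_right h2 h1
    have hsum_eq : n * l = m * k := by
      have : (n * l) ^ 2 = (m * k) ^ 2 := by
        rw [mul_pow, mul_pow, hk2, hl2, hs]
        linarith
      exact (pow_left_inj₀ (by positivity) (by positivity) two_ne_zero).1 this
    have hsum_pi : n * Real.pi * l = m * Real.pi * k := by
      linear_combination Real.pi * hsum_eq
    have hL := hleft_inj (le_antisymm hleft' (by linarith))
    have hR := hright_inj (le_antisymm hright' (by linarith))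
    intro x hx
    rcases le_total x x₀ with h | h
    · rw [hL x ⟨hx.1, h⟩, hs]
    · have := hR (1 - x) ⟨by linarith [hx.2], by linarith⟩
      rw [sub_sub_cancel] at this
      rw [this, hs]
  · have hmpos : (m : ℝ) ≠ 0 := by exact_mod_cast m.ne_zero
    rw [dirichlet_eigenvalue_eq_of_potential_zero hq hμ_mono hμ_eig hμ_all n,
      dirichlet_eigenvalue_eq_of_potential_zero hq hμ_mono hμ_eig hμ_all m, mul_pow, mul_pow,
      mul_div_mul_right _ _ (pow_ne_zero 2 Real.pi_ne_zero)]
end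

section
/- Let q : [0,1] → ℝ be continuous, nonpositive (q(x) ≤ 0 on [0,1]) and single-barrier. Then there exists ℓ₀ ∈ (0,1] such that, denoting by λ₁(ℓ₀) < λ₂(ℓ₀) < ⋯ the eigenvalues of the Dirichlet problem −y'' + q(x) y = λ y on [0,ℓ₀] with y(0) = y(ℓ₀) = 0, one has λ₁(ℓ₀) > 0 and λ_n(ℓ₀) / λ_m(ℓ₀) ≥ n² / m² for all n > m ≥ 1. -/
namespace DirichletRatio

open Set Filter Topology

/-! ### Calculus on intervals -/

theorem le_of_hasDerivAt_nonneg {f f' : ℝ → ℝ} {a b : ℝ} (hab : a ≤ b)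
    (hf : ∀ x ∈ Icc a b, HasDerivAt f (f' x) x) (h : ∀ x ∈ Icc a b, 0 ≤ f' x) : f a ≤ f b := by
  refine monotoneOn_of_hasDerivWithinAt_nonneg (f' := f') (convex_Icc a b)
    (fun x hx => (hf x hx).continuousAt.continuousWithinAt) (fun x hx => ?_) (fun x hx => ?_)
    (left_mem_Icc.2 hab) (right_mem_Icc.2 hab) hab
  · exact (hf x (interior_subset hx)).hasDerivWithinAt
  · exact h x (interior_subset hx)

theorem sub_le_of_hasDerivAt_le {f f' : ℝ → ℝ} {a b C : ℝ} (hab : a ≤ b)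
    (hf : ∀ x ∈ Icc a b, HasDerivAt f (f' x) x) (h : ∀ x ∈ Icc a b, f' x ≤ C) :
    f b - f a ≤ C * (b - a) := by
  have := le_of_hasDerivAt_nonneg (f := fun x => C * x - f x) hab
    (fun x hx => ((hasDerivAt_id x).const_mul C).sub (hf x hx))
    (fun x hx => by have := h x hx; linarith)
  linarith

theorem le_sub_of_le_hasDerivAt {f f' : ℝ → ℝ} {a b C : ℝ} (hab : a ≤ b)
    (hf : ∀ x ∈ Icc a b, HasDerivAt f (f' x) x) (h : ∀ x ∈ Icc a b, C ≤ f' x) :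
    C * (b - a) ≤ f b - f a := by
  have := sub_le_of_hasDerivAt_le (f := fun x => - f x) (C := -C) hab
    (fun x hx => (hf x hx).neg) (fun x hx => neg_le_neg (h x hx))
  linarith

theorem abs_sub_le_of_abs_hasDerivAt_le {f f' : ℝ → ℝ} {a b C : ℝ} (hab : a ≤ b)
    (hf : ∀ x ∈ Icc a b, HasDerivAt f (f' x) x) (h : ∀ x ∈ Icc a b, |f' x| ≤ C) :
    |f b - f a| ≤ C * (b - a) := by
  have h1 := sub_le_of_hasDerivAt_le hab hf (fun x hx => (abs_le.1 (h x hx)).2)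
  have h2 := le_sub_of_le_hasDerivAt hab hf (fun x hx => (abs_le.1 (h x hx)).1)
  exact abs_le.2 ⟨by linarith, h1⟩

/-- A nonnegative function with `|e'| ≤ K e` vanishing at one point vanishes identically. -/
theorem eq_zero_of_abs_deriv_le_mul {e e' : ℝ → ℝ} {a b c K : ℝ}
    (he : ∀ x ∈ Icc a b, HasDerivAt e (e' x) x) (hpos : ∀ x ∈ Icc a b, 0 ≤ e x)
    (hb : ∀ x ∈ Icc a b, |e' x| ≤ K * e x) (hc : c ∈ Icc a b) (hec : e c = 0) :
    ∀ x ∈ Icc a b, e x = 0 := by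
  have hexp : ∀ (k x : ℝ), HasDerivAt (fun t => Real.exp (k * t)) (Real.exp (k * x) * (k * 1)) x :=
    fun k x => ((hasDerivAt_id x).const_mul k).exp
  intro x hx
  refine le_antisymm ?_ (hpos x hx)
  rcases le_total c x with hcx | hxc
  · have hsub : Icc c x ⊆ Icc a b := Icc_subset_Icc hc.1 hx.2
    have := le_of_hasDerivAt_nonneg (f := fun t => -(e t * Real.exp (-K * t))) hcx
      (fun t ht => ((he t (hsub ht)).mul (hexp (-K) t)).neg) (fun t ht => by
        have h1 := (abs_le.1 (hb t (hsub ht))).2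
        have h2 := Real.exp_pos (-K * t)
        nlinarith)
    simp only [hec, zero_mul, neg_zero] at this
    exact nonpos_of_mul_nonpos_left (by linarith) (Real.exp_pos (-K * x))
  · have hsub : Icc x c ⊆ Icc a b := Icc_subset_Icc hx.1 hc.2
    have := le_of_hasDerivAt_nonneg (f := fun t => e t * Real.exp (K * t)) hxc
      (fun t ht => ((he t (hsub ht)).mul (hexp K t))) (fun t ht => by
        have h1 := (abs_le.1 (hb t (hsub ht))).1
        have h2 := Real.exp_pos (K * t)
        nlinarith)
    simp only [hec, zero_mul] at this
    exact nonpos_of_mul_nonpos_left this (Real.exp_pos (K * x))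

/-- A consequence of the second mean value theorem: if `D' ≤ p N'` with `p ≥ 0` decreasing and
`N ≤ 0 = N 0`, then `D ≤ 0`. -/
theorem nonpos_of_deriv_le_antitone_mul {D D' N N' p : ℝ → ℝ}
    (hD : ∀ x ∈ Icc (0 : ℝ) 1, HasDerivAt D (D' x) x)
    (hN : ∀ x ∈ Icc (0 : ℝ) 1, HasDerivAt N (N' x) x)
    (hN'c : ContinuousOn N' (Icc 0 1)) (hpc : Continuous p) (hpa : Antitone p)
    (hp0 : ∀ x, 0 ≤ p x) (hD0 : D 0 ≤ 0) (hN0 : N 0 = 0)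
    (hNn : ∀ x ∈ Icc (0 : ℝ) 1, N x ≤ 0) (hDN : ∀ x ∈ Icc (0 : ℝ) 1, D' x ≤ p x * N' x) :
    D 1 ≤ 0 := by
  obtain ⟨C, hC⟩ := isCompact_Icc.exists_bound_of_continuousOn hN'c
  have hC0 : 0 ≤ C := (norm_nonneg _).trans (hC 0 (by simp))
  have hinc : ∀ x ∈ Icc (0 : ℝ) 1, ∀ y ∈ Icc (0 : ℝ) 1, x ≤ y →
      (D y - p y * N y) - (D x - p x * N x) ≤ C * (p x - p y) * (y - x) := by
    intro x hx y hy hxy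
    have hsub : Icc x y ⊆ Icc (0 : ℝ) 1 := Icc_subset_Icc hx.1 hy.2
    have h1 := sub_le_of_hasDerivAt_le (f := fun s => D s - p y * N s) (C := C * (p x - p y)) hxy
      (fun s hs => (hD s (hsub hs)).sub ((hN s (hsub hs)).const_mul (p y))) (fun s hs => by
        have h2 := hDN s (hsub hs)
        have h3 := (abs_le.1 (hC s (hsub hs))).2
        have h4 := hpa hs.1
        have h5 := hpa hs.2
        have h6 : (p s - p y) * N' s ≤ (p s - p y) * C :=
          mul_le_mul_of_nonneg_left h3 (by linarith)
        nlinarith)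
    have h2 := mul_nonneg_of_nonpos_of_nonpos (sub_nonpos.2 (hpa hxy)) (hNn x hx)
    nlinarith
  have hVc : ContinuousOn (fun x => D x - p x * N x) (Icc 0 1) :=
    ContinuousOn.sub (fun x hx => (hD x hx).continuousAt.continuousWithinAt)
      (hpc.continuousOn.mul (fun x hx => (hN x hx).continuousAt.continuousWithinAt))
  have key := image_le_of_liminf_slope_right_le_deriv_boundary (B := fun _ => 0)
    (B' := fun _ => 0) hVc (by simpa [hN0] using hD0) continuousOn_const
    (fun x _ => hasDerivWithinAt_const _ _ _) (fun x hx r hr => by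
      have ht : Tendsto (fun y => C * (p x - p y)) (𝓝[>] x) (𝓝 0) := by
        have : Continuous fun y => C * (p x - p y) := by fun_prop
        simpa using (this.tendsto x).mono_left nhdsWithin_le_nhds
      have hev : ∀ᶠ y in 𝓝[>] x, slope (fun x => D x - p x * N x) x y < r := by
        filter_upwards [ht.eventually_lt_const hr, Ioo_mem_nhdsGT hx.2] with y hy hxy
        have h1 := hinc x ⟨hx.1, hx.2.le⟩ y ⟨hx.1.trans hxy.1.le, hxy.2.le⟩ hxy.1.le
        rw [slope_def_field, div_lt_iff₀ (sub_pos.2 hxy.1)]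
        exact h1.trans_lt (mul_lt_mul_of_pos_right hy (sub_pos.2 hxy.1))
      exact hev.frequently)
  have h1 : D 1 - p 1 * N 1 ≤ 0 := key (by simp : (1 : ℝ) ∈ Icc (0 : ℝ) 1)
  have h2 := mul_nonpos_of_nonneg_of_nonpos (hp0 1) (hNn 1 (by simp))
  linarith

/-- A priori bound for a linear differential inequality with small coefficient. -/
theorem abs_le_of_abs_deriv_le {D D' : ℝ → ℝ} {x α : ℝ} (hx : x ∈ Icc (0 : ℝ) 1)
    (hD : ∀ s ∈ Icc 0 x, HasDerivAt D (D' s) s) (hD0 : D 0 = 0)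
    (hb : ∀ s ∈ Icc 0 x, |D' s| ≤ α + |D s| / 2) : |D x| ≤ 2 * α * x := by
  have hDc : ContinuousOn (fun s => |D s|) (Icc 0 x) :=
    ContinuousOn.abs (fun s hs => (hD s hs).continuousAt.continuousWithinAt)
  obtain ⟨m, hm, hmax⟩ := isCompact_Icc.exists_isMaxOn (nonempty_Icc.2 hx.1) hDc
  have hmax' : ∀ s ∈ Icc 0 x, |D s| ≤ |D m| := fun s hs => hmax hs
  have hα : 0 ≤ α := by
    have := hb 0 (left_mem_Icc.2 hx.1)
    rw [hD0] at this
    have h2 := abs_nonneg (D' 0)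
    simp at this
    linarith
  have hstep : ∀ s ∈ Icc 0 x, |D s| ≤ (α + |D m| / 2) * s := by
    intro s hs
    have := abs_sub_le_of_abs_hasDerivAt_le (f := D) (C := α + |D m| / 2) hs.1
      (fun t ht => hD t ⟨ht.1, ht.2.trans hs.2⟩) (fun t ht => by
        have ht' : t ∈ Icc 0 x := ⟨ht.1, ht.2.trans hs.2⟩
        have h1 := hb t ht'
        have h2 := hmax' t ht'
        linarith)
    simpa [hD0] using this
  have h1 := hstep m hm
  have h2 := hstep x (right_mem_Icc.2 hx.1)
  have h3 := abs_nonneg (D m)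
  have hm1 : m ≤ 1 := hm.2.trans hx.2
  have h4 : |D m| ≤ α * m + |D m| / 2 := by nlinarith
  have h5 : |D m| ≤ 2 * α := by nlinarith
  nlinarith [hx.1]

/-! ### Trigonometric estimates -/

/-- The function `2 sin² φ - φ sin 2φ` governing the dependence of the angle on the frequency. -/
noncomputable def wave (φ : ℝ) : ℝ := 2 * Real.sin φ * (Real.sin φ - φ * Real.cos φ)

/-- The primitive of `wave` vanishing at `0`. -/
noncomputable def waveInt (φ : ℝ) : ℝ :=
  φ + φ * Real.cos (2 * φ) / 2 - 3 / 4 * Real.sin (2 * φ)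

theorem hasDerivAt_waveInt (φ : ℝ) : HasDerivAt waveInt (wave φ) φ := by
  have h2 : HasDerivAt (fun x : ℝ => 2 * x) (2 * 1) φ := (hasDerivAt_id φ).const_mul 2
  have h := ((hasDerivAt_id φ).add (((hasDerivAt_id φ).mul h2.cos).div_const 2)).sub
    (h2.sin.const_mul (3 / 4))
  refine h.congr_deriv ?_
  have := Real.sin_sq_add_cos_sq φ
  simp only [id, wave, Real.cos_two_mul, Real.sin_two_mul]
  linear_combination (-2 : ℝ) * this

theorem hasDerivAt_sin_sub_mul_cos (φ : ℝ) :
    HasDerivAt (fun x => Real.sin x - x * Real.cos x) (φ * Real.sin φ) φ := by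
  refine ((Real.hasDerivAt_sin φ).sub ((hasDerivAt_id φ).mul (Real.hasDerivAt_cos φ))).congr_deriv ?_
  simp

theorem hasDerivAt_cube (φ : ℝ) : HasDerivAt (fun x : ℝ => x ^ 3) (3 * φ ^ 2) φ := by
  simpa using hasDerivAt_pow 3 φ

theorem abs_sin_sub_mul_cos_le {φ : ℝ} (hφ : 0 ≤ φ) :
    |Real.sin φ - φ * Real.cos φ| ≤ φ ^ 3 / 2 := by
  have hs : ∀ x ∈ Icc 0 φ, |x * Real.sin x| ≤ x ^ 2 := fun x hx => by
    rw [abs_mul, abs_of_nonneg hx.1]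
    have := Real.abs_sin_le_abs (x := x)
    rw [abs_of_nonneg hx.1] at this
    nlinarith [hx.1]
  have h1 := le_of_hasDerivAt_nonneg hφ
    (fun x _ => ((hasDerivAt_cube x).div_const 2).sub (hasDerivAt_sin_sub_mul_cos x))
    (fun x hx => by have := (abs_le.1 (hs x hx)).2; nlinarith [sq_nonneg x])
  have h2 := le_of_hasDerivAt_nonneg hφ
    (fun x _ => ((hasDerivAt_cube x).div_const 2).add (hasDerivAt_sin_sub_mul_cos x))
    (fun x hx => by have := (abs_le.1 (hs x hx)).1; nlinarith [sq_nonneg x])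
  simp at h1 h2
  exact abs_le.2 ⟨by linarith, by linarith⟩

theorem sin_sub_mul_cos_nonneg {φ : ℝ} (hφ : 0 ≤ φ) (hφ' : φ ≤ Real.pi) :
    0 ≤ Real.sin φ - φ * Real.cos φ := by
  have h1 := le_of_hasDerivAt_nonneg hφ (fun x _ => hasDerivAt_sin_sub_mul_cos x)
    (fun x hx => mul_nonneg hx.1 (Real.sin_nonneg_of_nonneg_of_le_pi hx.1 (hx.2.trans hφ')))
  simpa using h1

theorem half_le_sin {φ : ℝ} (hφ : 0 ≤ φ) (hφ' : φ ≤ Real.pi / 2) : φ / 2 ≤ Real.sin φ := by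
  refine le_trans ?_ (Real.mul_le_sin hφ hφ')
  have : 1 / 2 ≤ 2 / Real.pi := by
    rw [div_le_div_iff₀ two_pos Real.pi_pos]
    linarith [Real.pi_le_four]
  nlinarith

theorem cube_le_sin_sub_mul_cos {φ : ℝ} (hφ : 0 ≤ φ) (hφ' : φ ≤ Real.pi / 2) :
    φ ^ 3 / 6 ≤ Real.sin φ - φ * Real.cos φ := by
  have h1 := le_of_hasDerivAt_nonneg hφ
    (fun x _ => (hasDerivAt_sin_sub_mul_cos x).sub ((hasDerivAt_cube x).div_const 6))
    (fun x hx => by nlinarith [half_le_sin hx.1 (hx.2.trans hφ'), hx.1])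
  simp at h1
  linarith

theorem abs_wave_le_linear {φ : ℝ} (hφ : 0 ≤ φ) : |wave φ| ≤ 4 * φ := by
  have h1 := Real.abs_sin_le_abs (x := φ)
  rw [abs_of_nonneg hφ] at h1
  have h2 : |φ * Real.cos φ| ≤ φ := by
    rw [abs_mul, abs_of_nonneg hφ]
    nlinarith [Real.abs_cos_le_one φ]
  have h3 : |Real.sin φ - φ * Real.cos φ| ≤ 2 * φ := by
    have := abs_sub (Real.sin φ) (φ * Real.cos φ)
    linarith
  rw [wave, abs_mul, abs_mul, abs_two]
  have h4 := Real.abs_sin_le_one φ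
  have h5 := mul_le_mul h4 h3 (abs_nonneg _) zero_le_one
  linarith

theorem abs_wave_le_pow {φ : ℝ} (hφ : 0 ≤ φ) : |wave φ| ≤ φ ^ 4 := by
  have h1 := Real.abs_sin_le_abs (x := φ)
  rw [abs_of_nonneg hφ] at h1
  rw [wave, abs_mul, abs_mul, abs_two]
  have h5 := mul_le_mul h1 (abs_sin_sub_mul_cos_le hφ) (abs_nonneg _) hφ
  linarith

theorem waveInt_lower {φ : ℝ} (hφ : 0 ≤ φ) : φ ^ 5 / (1 + φ ^ 4) / 30 ≤ waveInt φ := by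
  have hlin : φ ^ 5 / (1 + φ ^ 4) ≤ φ := by
    rw [div_le_iff₀ (by positivity)]
    linarith
  have hpow : φ ^ 5 / (1 + φ ^ 4) ≤ φ ^ 5 :=
    div_le_self (by positivity) (le_add_of_nonneg_right (by positivity))
  have hpi := Real.pi_gt_three
  rcases le_total φ (Real.pi / 2) with h | h
  · have h1 := le_of_hasDerivAt_nonneg hφ
      (fun x _ => (hasDerivAt_waveInt x).sub ((hasDerivAt_pow 5 x).div_const 30))
      (fun x hx => by
        have h2 := half_le_sin hx.1 (hx.2.trans h)
        have h3 := cube_le_sin_sub_mul_cos hx.1 (hx.2.trans h)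
        have h4 := mul_le_mul h2 h3 (by have := hx.1; positivity)
          (by have := hx.1; linarith)
        simp only [wave]
        norm_num
        nlinarith)
    simp [waveInt] at h1
    simp only [waveInt]
    linarith
  rcases le_total φ Real.pi with h' | h'
  · have h1 := le_of_hasDerivAt_nonneg h (fun x _ => hasDerivAt_waveInt x)
      (fun x hx => by
        have hx0 : 0 ≤ x := by linarith [hx.1]
        have h2 := Real.sin_nonneg_of_nonneg_of_le_pi hx0 (hx.2.trans h')
        have h3 := sin_sub_mul_cos_nonneg hx0 (hx.2.trans h')
        exact mul_nonneg (by linarith) h3)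
    have h2 : waveInt (Real.pi / 2) = Real.pi / 4 := by
      have : 2 * (Real.pi / 2) = Real.pi := by ring
      simp only [waveInt, this, Real.cos_pi, Real.sin_pi]
      ring
    linarith
  · have h1 := Real.neg_one_le_cos (2 * φ)
    have h2 := Real.sin_le_one (2 * φ)
    simp only [waveInt]
    nlinarith

/-- The function `sin² (ζ t) / ζ²`. -/
noncomputable def sinSq (ζ t : ℝ) : ℝ := Real.sin (ζ * t) ^ 2 / ζ ^ 2

/-- The primitive of `sinSq ζ` vanishing at `0`. -/
noncomputable def sinSqInt (ζ t : ℝ) : ℝ :=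
  (t / ζ ^ 2 - Real.sin (2 * ζ * t) / (2 * ζ ^ 3)) / 2

theorem sinSq_nonneg (ζ t : ℝ) : 0 ≤ sinSq ζ t := by unfold sinSq; positivity

theorem sinSq_le (ζ t : ℝ) : sinSq ζ t ≤ 1 / ζ ^ 2 :=
  div_le_div_of_nonneg_right (Real.sin_sq_le_one _) (sq_nonneg ζ)

theorem sinSq_le_one {ζ : ℝ} (hζ : 1 ≤ ζ) (t : ℝ) : sinSq ζ t ≤ 1 :=
  (sinSq_le ζ t).trans (by rw [div_le_one (by positivity)]; nlinarith)

theorem continuous_sinSq (ζ : ℝ) : Continuous (sinSq ζ) := by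
  unfold sinSq; fun_prop

theorem hasDerivAt_sinSq {ζ : ℝ} (hζ : 0 < ζ) (t : ℝ) :
    HasDerivAt (sinSq ζ) (2 * Real.sin (ζ * t) * Real.cos (ζ * t) / ζ) t := by
  refine ((((hasDerivAt_id t).const_mul ζ).sin.pow 2).div_const (ζ ^ 2)).congr_deriv ?_
  simp only [id]
  field_simp
  norm_num
  ring

theorem abs_sinSq_sub_le {ζ : ℝ} (hζ : 0 < ζ) (s t : ℝ) :
    |sinSq ζ t - sinSq ζ s| ≤ |t - s| / ζ := by
  have key : ∀ x, |2 * Real.sin (ζ * x) * Real.cos (ζ * x) / ζ| ≤ 1 / ζ := fun x => by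
    rw [← Real.sin_two_mul, abs_div, abs_of_pos hζ]
    exact div_le_div_of_nonneg_right (Real.abs_sin_le_one _) hζ.le
  rcases le_total s t with h | h
  · have := abs_sub_le_of_abs_hasDerivAt_le h (fun x _ => hasDerivAt_sinSq hζ x)
      (fun x _ => key x)
    rw [abs_of_nonneg (sub_nonneg.2 h)]
    exact this.trans_eq (by ring)
  · have := abs_sub_le_of_abs_hasDerivAt_le h (fun x _ => hasDerivAt_sinSq hζ x)
      (fun x _ => key x)
    rw [abs_sub_comm, abs_sub_comm t, abs_of_nonneg (sub_nonneg.2 h)]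
    exact this.trans_eq (by ring)

theorem hasDerivAt_sinSqInt {ζ : ℝ} (hζ : 0 < ζ) (t : ℝ) :
    HasDerivAt (sinSqInt ζ) (sinSq ζ t) t := by
  refine ((((hasDerivAt_id t).div_const (ζ ^ 2)).sub
    ((((hasDerivAt_id t).const_mul (2 * ζ)).sin).div_const (2 * ζ ^ 3))).div_const 2).congr_deriv ?_
  have h1 : 2 * ζ * t = 2 * (ζ * t) := by ring
  simp only [id, sinSq, h1, Real.cos_two_mul, Real.sin_sq]
  field_simp
  ring

theorem hasDerivAt_sinSq_param {ζ : ℝ} (hζ : 0 < ζ) (t : ℝ) :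
    HasDerivAt (fun ζ => sinSq ζ t) (-wave (ζ * t) / ζ ^ 3) ζ := by
  refine ((((hasDerivAt_id ζ).mul_const t).sin.pow 2).div (hasDerivAt_pow 2 ζ)
    (by positivity)).congr_deriv ?_
  simp only [id, wave, Pi.pow_apply]
  field_simp
  push_cast
  ring

theorem hasDerivAt_sinSqInt_param {ζ : ℝ} (hζ : 0 < ζ) (t : ℝ) :
    HasDerivAt (fun ζ => sinSqInt ζ t) (-waveInt (ζ * t) / ζ ^ 4) ζ := by
  have h2 : HasDerivAt (fun x : ℝ => 2 * x * t) (2 * 1 * t) ζ :=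
    ((hasDerivAt_id ζ).const_mul 2).mul_const t
  have h := (((hasDerivAt_const ζ t).div (hasDerivAt_pow 2 ζ) (by positivity)).sub
    (h2.sin.div ((hasDerivAt_pow 3 ζ).const_mul 2) (by positivity))).div_const 2
  refine h.congr_deriv ?_
  have h1 : 2 * ζ * t = 2 * (ζ * t) := by ring
  simp only [waveInt, h1]
  field_simp
  push_cast
  ring

theorem abs_sinSq_sub_param_le {z w t : ℝ} (hz : 0 < z) (hzw : z ≤ w) (ht : 0 ≤ t) :
    |sinSq w t - sinSq z t| ≤ 4 * t / z ^ 2 * (w - z) := by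
  refine abs_sub_le_of_abs_hasDerivAt_le (f := fun ζ => sinSq ζ t) hzw
    (fun ζ hζ => hasDerivAt_sinSq_param (hz.trans_le hζ.1) t) (fun ζ hζ => ?_)
  have hζ0 : 0 < ζ := hz.trans_le hζ.1
  rw [abs_div, abs_neg, abs_of_pos (by positivity : 0 < ζ ^ 3)]
  calc |wave (ζ * t)| / ζ ^ 3 ≤ 4 * (ζ * t) / ζ ^ 3 := by
        gcongr; exact abs_wave_le_linear (by positivity)
    _ = 4 * t / ζ ^ 2 := by field_simp
    _ ≤ 4 * t / z ^ 2 := by gcongr; exact hζ.1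

theorem abs_sinSq_sub_param_le_pow {z w t : ℝ} (hz : 0 < z) (hzw : z ≤ w) (hw : w ≤ 2 * z)
    (ht : 0 ≤ t) : |sinSq w t - sinSq z t| ≤ 2 * z * t ^ 4 * (w - z) := by
  refine abs_sub_le_of_abs_hasDerivAt_le (f := fun ζ => sinSq ζ t) hzw
    (fun ζ hζ => hasDerivAt_sinSq_param (hz.trans_le hζ.1) t) (fun ζ hζ => ?_)
  have hζ0 : 0 < ζ := hz.trans_le hζ.1
  rw [abs_div, abs_neg, abs_of_pos (by positivity : 0 < ζ ^ 3)]
  calc |wave (ζ * t)| / ζ ^ 3 ≤ (ζ * t) ^ 4 / ζ ^ 3 := by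
        gcongr; exact abs_wave_le_pow (by positivity)
    _ = ζ * t ^ 4 := by field_simp
    _ ≤ 2 * z * t ^ 4 := by gcongr; exact hζ.2.trans hw

theorem pow_div_one_add_pow_mono {x y : ℝ} (hx : 0 ≤ x) (hxy : x ≤ y) :
    x ^ 5 / (1 + x ^ 4) ≤ y ^ 5 / (1 + y ^ 4) := by
  have hy : 0 ≤ y := hx.trans hxy
  rw [div_le_div_iff₀ (by positivity) (by positivity)]
  have h1 : x ^ 5 ≤ y ^ 5 := pow_le_pow_left₀ hx hxy 5
  have h2 : x ^ 4 * y ^ 4 * x ≤ x ^ 4 * y ^ 4 * y := by gcongr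
  nlinarith

theorem sinSqInt_sub_param_le {z w x t : ℝ} (hz : 0 < z) (hzw : z ≤ w) (hw : w ≤ 2 * z)
    (hx : 0 ≤ x) (hxt : x ≤ t) :
    sinSqInt w t - sinSqInt z t ≤ -(((z * x) ^ 5 / (1 + (z * x) ^ 4)) / (480 * z ^ 4)) * (w - z) := by
  have ht := hx.trans hxt
  refine sub_le_of_hasDerivAt_le hzw
    (fun ζ hζ => hasDerivAt_sinSqInt_param (hz.trans_le hζ.1) t) (fun ζ hζ => ?_)
  have hζ0 : 0 < ζ := hz.trans_le hζ.1
  rw [neg_div, neg_le_neg_iff]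
  have h1 : (z * x) ^ 5 / (1 + (z * x) ^ 4) / 30 ≤ waveInt (ζ * t) := by
    refine le_trans ?_ (waveInt_lower (by positivity))
    gcongr ?_ / 30
    exact pow_div_one_add_pow_mono (by positivity) (mul_le_mul hζ.1 hxt hx hζ0.le)
  have h0 : 0 ≤ (z * x) ^ 5 / (1 + (z * x) ^ 4) := by positivity
  calc ((z * x) ^ 5 / (1 + (z * x) ^ 4)) / (480 * z ^ 4)
      = (z * x) ^ 5 / (1 + (z * x) ^ 4) / 30 / (2 * z) ^ 4 := by field_simp; ring
    _ ≤ (z * x) ^ 5 / (1 + (z * x) ^ 4) / 30 / ζ ^ 4 := by gcongr; exact hζ.2.trans hw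
    _ ≤ waveInt (ζ * t) / ζ ^ 4 := by gcongr

/-! ### The Prüfer angle -/

/-- `p` is continuous, decreasing, nonnegative and small. -/
structure IsSmallDecreasing (p : ℝ → ℝ) : Prop where
  cont : Continuous p
  anti : Antitone p
  nonneg : ∀ x, 0 ≤ p x
  le : ∀ x, p x ≤ 1 / 100000

/-- `θ` is the rescaled Prüfer angle of the solution of `-y'' - p y = z² y`, `y 0 = 0`. -/
structure IsAngle (p : ℝ → ℝ) (z : ℝ) (θ : ℝ → ℝ) : Prop where
  zero : θ 0 = 0
  deriv : ∀ x ∈ Icc (0 : ℝ) 1, HasDerivAt θ (1 + p x * sinSq z (θ x)) x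

section

variable {p : ℝ → ℝ} {z w : ℝ} {θ η : ℝ → ℝ}

theorem mul_sinSq_mem (hp : IsSmallDecreasing p) (hz : 1 ≤ z) (x t : ℝ) :
    0 ≤ p x * sinSq z t ∧ p x * sinSq z t ≤ 1 := by
  have h1 := hp.nonneg x
  have h2 := hp.le x
  have h3 := sinSq_nonneg z t
  have h4 := sinSq_le_one hz t
  constructor <;> nlinarith

theorem exists_isAngle (hp : IsSmallDecreasing p) (hz : 1 ≤ z) : ∃ θ, IsAngle p z θ := by
  have hz0 : 0 < z := by linarith
  have hPL : IsPicardLindelof (fun x t => 1 + p x * sinSq z t) (tmin := -1) (tmax := 2)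
      ⟨0, by norm_num, by norm_num⟩ (0 : ℝ) 4 0 2 1 := by
    refine ⟨fun x _ => ?_, fun t _ => ?_, fun x _ t _ => ?_, ?_⟩
    · refine LipschitzOnWith.of_dist_le_mul fun s _ t _ => ?_
      simp only [Real.dist_eq, NNReal.coe_one, one_mul, add_sub_add_left_eq_sub, ← mul_sub]
      rw [abs_mul, abs_of_nonneg (hp.nonneg x)]
      have h1 := abs_sinSq_sub_le hz0 t s
      have h2 : |s - t| / z ≤ |s - t| := div_le_self (abs_nonneg _) hz
      have h3 := hp.le x
      have h4 := hp.nonneg x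
      have h5 := abs_nonneg (sinSq z s - sinSq z t)
      nlinarith
    · exact (continuous_const.add (hp.cont.mul continuous_const)).continuousOn
    · obtain ⟨h1, h2⟩ := mul_sinSq_mem hp hz x t
      rw [Real.norm_eq_abs, abs_of_nonneg (by linarith)]
      push_cast
      linarith
    · norm_num
  obtain ⟨θ, h0, hθ⟩ := hPL.exists_eq_forall_mem_Icc_hasDerivWithinAt₀
  refine ⟨θ, h0, fun x hx => (hθ x ⟨?_, ?_⟩).hasDerivAt (Icc_mem_nhds ?_ ?_)⟩ <;>
    linarith [hx.1, hx.2]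

namespace IsAngle

theorem le_self (hp : IsSmallDecreasing p) (hz : 1 ≤ z) (hθ : IsAngle p z θ) {x : ℝ}
    (hx : x ∈ Icc (0 : ℝ) 1) : x ≤ θ x ∧ θ x ≤ 2 * x := by
  have hsub : ∀ s ∈ Icc 0 x, s ∈ Icc (0 : ℝ) 1 := fun s hs => ⟨hs.1, hs.2.trans hx.2⟩
  have h1 := le_sub_of_le_hasDerivAt (C := 1) hx.1 (fun s hs => hθ.deriv s (hsub s hs))
    (fun s _ => by have := (mul_sinSq_mem hp hz s (θ s)).1; linarith)
  have h2 := sub_le_of_hasDerivAt_le (C := 2) hx.1 (fun s hs => hθ.deriv s (hsub s hs))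
    (fun s _ => by have := (mul_sinSq_mem hp hz s (θ s)).2; linarith)
  rw [hθ.zero] at h1 h2
  constructor <;> linarith

theorem continuousOn (hθ : IsAngle p z θ) : ContinuousOn θ (Icc 0 1) :=
  fun x hx => (hθ.deriv x hx).continuousAt.continuousWithinAt

theorem hasDerivAt_sub (hθ : IsAngle p z θ) (hη : IsAngle p w η) {x : ℝ}
    (hx : x ∈ Icc (0 : ℝ) 1) : HasDerivAt (fun s => η s - θ s)
      (p x * (sinSq w (η x) - sinSq z (θ x))) x :=
  ((hη.deriv x hx).sub (hθ.deriv x hx)).congr_deriv (by ring)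

theorem abs_sub_le (hp : IsSmallDecreasing p) (hz : 1 ≤ z) (hθ : IsAngle p z θ)
    (hη : IsAngle p w η) {x α : ℝ} (hx : x ∈ Icc (0 : ℝ) 1)
    (hα : ∀ s ∈ Icc 0 x, |sinSq w (η s) - sinSq z (η s)| ≤ α) :
    |η x - θ x| ≤ 2 * (1 / 100000 * α) * x := by
  refine abs_le_of_abs_deriv_le (D := fun s => η s - θ s) hx
    (fun s hs => hθ.hasDerivAt_sub hη ⟨hs.1, hs.2.trans hx.2⟩) (by simp [hθ.zero, hη.zero])
    (fun s hs => ?_)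
  have h1 := abs_sinSq_sub_le (by linarith : 0 < z) (θ s) (η s)
  have h2 : |η s - θ s| / z ≤ |η s - θ s| := div_le_self (abs_nonneg _) hz
  have h3 := hα s hs
  have h4 := _root_.abs_sub_le (sinSq w (η s)) (sinSq z (η s)) (sinSq z (θ s))
  have h5 := abs_nonneg (sinSq w (η s) - sinSq z (θ s))
  have h6 := abs_nonneg (η s - θ s)
  rw [abs_mul, abs_of_nonneg (hp.nonneg s)]
  calc p s * |sinSq w (η s) - sinSq z (θ s)|
      ≤ 1 / 100000 * |sinSq w (η s) - sinSq z (θ s)| := mul_le_mul_of_nonneg_right (hp.le s) h5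
    _ ≤ 1 / 100000 * α + |η s - θ s| / 2 := by linarith

theorem abs_sub_one_le (hp : IsSmallDecreasing p) (hz : 1 ≤ z) (hzw : z ≤ w)
    (hθ : IsAngle p z θ) (hη : IsAngle p w η) : |η 1 - θ 1| ≤ (w - z) / (2 * z) := by
  have hz0 : 0 < z := by linarith
  have h := abs_sub_le hp hz hθ hη (α := 4 * 2 / z ^ 2 * (w - z)) (right_mem_Icc.2 zero_le_one)
    (fun s hs => by
      obtain ⟨h1, h2⟩ := hη.le_self hp (hz.trans hzw) hs
      refine (abs_sinSq_sub_param_le hz0 hzw (hs.1.trans h1)).trans ?_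
      have : 0 ≤ w - z := by linarith
      gcongr
      linarith [hs.2])
  refine h.trans ?_
  have h1 : 1 / z ^ 2 ≤ 1 / z := by
    apply one_div_le_one_div_of_le hz0
    nlinarith
  have h2 : (w - z) * (1 / z ^ 2) ≤ (w - z) * (1 / z) :=
    mul_le_mul_of_nonneg_left h1 (by linarith)
  have h3 : 0 ≤ (w - z) * (1 / z) := mul_nonneg (by linarith) (by positivity)
  calc 2 * (1 / 100000 * (4 * 2 / z ^ 2 * (w - z))) * 1
      = 16 / 100000 * ((w - z) * (1 / z ^ 2)) := by ring
    _ ≤ 1 / 2 * ((w - z) * (1 / z)) := by linarith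
    _ = (w - z) / (2 * z) := by field_simp

theorem mul_sub_mul_mem (hp : IsSmallDecreasing p) (hz : 1 ≤ z) (hzw : z ≤ w)
    (hθ : IsAngle p z θ) (hη : IsAngle p w η) :
    (w - z) / 2 ≤ w * η 1 - z * θ 1 ∧ w * η 1 - z * θ 1 ≤ 3 * (w - z) := by
  have hz0 : 0 < z := by linarith
  obtain ⟨h1, h2⟩ := abs_le.1 (abs_sub_one_le hp hz hzw hθ hη)
  obtain ⟨h3, h4⟩ := hη.le_self hp (hz.trans hzw) (right_mem_Icc.2 zero_le_one)
  have h5 : z * ((w - z) / (2 * z)) = (w - z) / 2 := by field_simp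
  have h6 := mul_le_mul_of_nonneg_left h1 hz0.le
  have h7 := mul_le_mul_of_nonneg_left h2 hz0.le
  constructor <;> nlinarith

/-- The error terms in the comparison of two angles are dominated by a multiple of the derivative of
`(z x) ^ 5 / (1 + (z x) ^ 4)`. -/
theorem error_le {d x : ℝ} (hz : 1 ≤ z) (hd : 0 ≤ d) (hx : x ∈ Icc (0 : ℝ) 1) :
    1 / 100000 * min (8 * x / z ^ 2 * d) (32 * z * x ^ 4 * d) * (2 * x / z + 1 / z ^ 2) ≤
      d / (500 * z ^ 4) * ((5 * (z * x) ^ 4 + (z * x) ^ 8) / (1 + (z * x) ^ 4) ^ 2 * z) := by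
  obtain ⟨hx0, hx1⟩ := hx
  have hz0 : 0 < z := by linarith
  have hfac : (z * x) ^ 4 / (1 + (z * x) ^ 4) ≤
      (5 * (z * x) ^ 4 + (z * x) ^ 8) / (1 + (z * x) ^ 4) ^ 2 := by
    rw [div_le_div_iff₀ (by positivity) (by positivity)]
    have : 0 ≤ (z * x) ^ 4 := by positivity
    have h8 : (z * x) ^ 8 = (z * x) ^ 4 * (z * x) ^ 4 := by ring
    rw [h8]
    generalize (z * x) ^ 4 = u at *
    nlinarith [mul_nonneg this this]
  rcases le_total (z * x) 1 with h | h
  · have h1 : 2 * x / z + 1 / z ^ 2 ≤ 3 / z ^ 2 := by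
      rw [div_add_div _ _ hz0.ne' (by positivity), div_le_div_iff₀ (by positivity) (by positivity)]
      have : 2 * x * z ^ 2 + z * 1 ≤ 3 * z := by nlinarith
      nlinarith [sq_nonneg z]
    have h2 : (z * x) ^ 4 / 2 ≤ (z * x) ^ 4 / (1 + (z * x) ^ 4) := by
      gcongr
      have := pow_le_one₀ (n := 4) (by positivity) h
      linarith
    have h3 : x ^ 4 ≤ z ^ 2 * x ^ 4 := le_mul_of_one_le_left (by positivity) (by nlinarith)
    calc _ ≤ 1 / 100000 * (32 * z * x ^ 4 * d) * (3 / z ^ 2) := by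
          gcongr; exact min_le_right _ _
      _ = 96 / 100000 * d / z * x ^ 4 := by field_simp; ring
      _ ≤ 96 / 100000 * d / z * (z ^ 2 * x ^ 4) := by gcongr
      _ ≤ 1 / 1000 * d / z * (z ^ 2 * x ^ 4) := by gcongr ?_ * _ / _ * _; norm_num
      _ = d / (500 * z ^ 4) * ((z * x) ^ 4 / 2 * z) := by field_simp; ring
      _ ≤ _ := by gcongr _ * (?_ * _); exact h2.trans hfac
  · have h1 : 2 * x / z + 1 / z ^ 2 ≤ 3 / z := by
      rw [div_add_div _ _ hz0.ne' (by positivity), div_le_div_iff₀ (by positivity) (by positivity)]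
      have : 2 * x * z ^ 2 + z * 1 ≤ 3 * z ^ 2 := by nlinarith
      nlinarith
    have h2 : 1 / 2 ≤ (z * x) ^ 4 / (1 + (z * x) ^ 4) := by
      rw [div_le_div_iff₀ (by norm_num) (by positivity)]
      have := one_le_pow₀ (n := 4) h
      linarith
    calc _ ≤ 1 / 100000 * (8 * 1 / z ^ 2 * d) * (3 / z) := by
          gcongr; exact (min_le_left _ _).trans (by gcongr)
      _ = 24 / 100000 * (d / z ^ 3) := by field_simp; ring
      _ ≤ 1 / 1000 * (d / z ^ 3) := by gcongr ?_ * _; norm_num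
      _ = d / (500 * z ^ 4) * (1 / 2 * z) := by field_simp; ring
      _ ≤ _ := by gcongr _ * (?_ * _); exact h2.trans hfac

theorem hasDerivAt_pow_div (c x : ℝ) :
    HasDerivAt (fun s => c * ((z * s) ^ 5 / (1 + (z * s) ^ 4)))
      (c * ((5 * (z * x) ^ 4 + (z * x) ^ 8) / (1 + (z * x) ^ 4) ^ 2 * z)) x := by
  have hpos : 1 + (z * x) ^ 4 ≠ 0 := by positivity
  have h := (hasDerivAt_id x).const_mul z
  refine ((((h.pow 5).div ((h.pow 4).const_add 1) hpos)).const_mul c).congr_deriv ?_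
  simp only [id, Pi.pow_apply]
  field_simp
  push_cast
  ring

/-- The rescaled angle at `1` decreases in the frequency, for nearby frequencies. -/
theorem le_of_le_two_mul (hp : IsSmallDecreasing p) (hz : 1 ≤ z) (hzw : z ≤ w)
    (hw : w ≤ 2 * z) (hθ : IsAngle p z θ) (hη : IsAngle p w η) : η 1 ≤ θ 1 := by
  have hz0 : 0 < z := by linarith
  have hw0 : 0 < w := by linarith
  have hd : 0 ≤ w - z := by linarith
  have h0 : sinSqInt w 0 - sinSqInt z 0 = 0 := by simp [sinSqInt]
  have hsw := continuous_sinSq w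
  have hsz := continuous_sinSq z
  have hcont := hη.continuousOn
  have hpc := hp.cont
  have hne : ∀ x : ℝ, (1 + (z * x) ^ 4) ^ 2 ≠ 0 := fun x => by positivity
  refine sub_nonpos.1 (nonpos_of_deriv_le_antitone_mul (D := fun s => η s - θ s)
    (N := fun s => (sinSqInt w (η s) - sinSqInt z (η s)) +
      (w - z) / (500 * z ^ 4) * ((z * s) ^ 5 / (1 + (z * s) ^ 4)))
    (N' := fun x => (sinSq w (η x) - sinSq z (η x)) * (1 + p x * sinSq w (η x)) +
      (w - z) / (500 * z ^ 4) *
        ((5 * (z * x) ^ 4 + (z * x) ^ 8) / (1 + (z * x) ^ 4) ^ 2 * z))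
    (p := p) (fun x hx => hθ.hasDerivAt_sub hη hx) (fun x hx => ?_) ?_ hp.cont hp.anti hp.nonneg
    (by simp [hθ.zero, hη.zero]) (by simp [hη.zero, h0]) (fun x hx => ?_) (fun x hx => ?_))
  · refine HasDerivAt.add ?_ (hasDerivAt_pow_div _ x)
    exact (((hasDerivAt_sinSqInt hw0 (η x)).sub (hasDerivAt_sinSqInt hz0 (η x))).comp x
      (hη.deriv x hx))
  · have h1 := hsw.comp_continuousOn hcont
    have h2 := hsz.comp_continuousOn hcont
    refine ((h1.sub h2).mul (continuousOn_const.add (hpc.continuousOn.mul h1))).add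
      (Continuous.continuousOn ?_)
    exact continuous_const.mul ((Continuous.div (by fun_prop) (by fun_prop) hne).mul
      continuous_const)
  · have h1 := sinSqInt_sub_param_le hz0 hzw hw hx.1 (hη.le_self hp (hz.trans hzw) hx).1
    refine (add_le_add_left h1 _).trans ?_
    have hx0 := hx.1
    have h2 : 0 ≤ (z * x) ^ 5 / (1 + (z * x) ^ 4) := by positivity
    have h3 : (w - z) / (500 * z ^ 4) * ((z * x) ^ 5 / (1 + (z * x) ^ 4)) ≤
        (w - z) / (480 * z ^ 4) * ((z * x) ^ 5 / (1 + (z * x) ^ 4)) := by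
      gcongr
      norm_num
    refine (add_le_add_right h3 _).trans (le_of_eq ?_)
    ring
  · set α := min (8 * x / z ^ 2 * (w - z)) (32 * z * x ^ 4 * (w - z)) with hαdef
    have hα : ∀ s ∈ Icc 0 x, |sinSq w (η s) - sinSq z (η s)| ≤ α := fun s hs => by
      obtain ⟨h1, h2⟩ := hη.le_self hp (hz.trans hzw) ⟨hs.1, hs.2.trans hx.2⟩
      have h3 : η s ≤ 2 * x := by linarith [hs.2]
      have h4 : 0 ≤ η s := hs.1.trans h1
      refine le_min ((abs_sinSq_sub_param_le hz0 hzw h4).trans ?_)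
        ((abs_sinSq_sub_param_le_pow hz0 hzw hw h4).trans ?_)
      · gcongr ?_ / _ * _
        linarith
      · calc 2 * z * η s ^ 4 * (w - z) ≤ 2 * z * (2 * x) ^ 4 * (w - z) := by gcongr
          _ = 32 * z * x ^ 4 * (w - z) := by ring
    have hD := abs_sub_le hp hz hθ hη hx hα
    have ha := hα x (right_mem_Icc.2 hx.1)
    have hα0 : 0 ≤ α := (abs_nonneg _).trans ha
    have hS := (abs_le.1 (abs_sinSq_sub_le hz0 (θ x) (η x))).2
    have hS2 : |η x - θ x| / z ≤ 1 / 100000 * α * (2 * x / z) := by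
      rw [div_le_iff₀ hz0]
      refine hD.trans (le_of_eq ?_)
      field_simp
    have hpS : |(sinSq w (η x) - sinSq z (η x)) * (p x * sinSq w (η x))| ≤
        1 / 100000 * α * (1 / z ^ 2) := by
      rw [abs_mul, abs_of_nonneg (mul_sinSq_mem hp (hz.trans hzw) x (η x)).1]
      calc _ ≤ α * (1 / 100000 * (1 / z ^ 2)) := by
            gcongr
            · exact (mul_sinSq_mem hp (hz.trans hzw) x (η x)).1
            · exact sinSq_nonneg w _
            · exact hp.le x
            · exact (sinSq_le w _).trans (by gcongr)
        _ = _ := by ring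
    have herr := error_le hz hd hx
    rw [← hαdef] at herr
    refine mul_le_mul_of_nonneg_left ?_ (hp.nonneg x)
    have h1 := (abs_le.1 hpS).1
    linarith

end IsAngle

end

/-! ### Eigenvalues and the Prüfer angle -/

section

variable {p : ℝ → ℝ} {z w : ℝ} {θ : ℝ → ℝ}

theorem eq_zero_of_initial_eq_zero {y y' g : ℝ → ℝ} {a b c K : ℝ}
    (hy : ∀ x ∈ Icc a b, HasDerivAt y (y' x) x)
    (hy' : ∀ x ∈ Icc a b, HasDerivAt y' (g x * y x) x) (hg : ∀ x ∈ Icc a b, |g x| ≤ K)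
    (hc : c ∈ Icc a b) (h0 : y c = 0) (h0' : y' c = 0) : ∀ x ∈ Icc a b, y x = 0 := by
  have h := eq_zero_of_abs_deriv_le_mul (e := fun x => y x ^ 2 + y' x ^ 2)
    (e' := fun x => 2 * (1 + g x) * (y x * y' x)) (K := 1 + K)
    (fun x hx => (((hy x hx).pow 2).add ((hy' x hx).pow 2)).congr_deriv (by push_cast; ring))
    (fun x _ => by positivity) (fun x hx => ?_) hc (by simp [h0, h0'])
  · intro x hx
    have := h x hx
    nlinarith [sq_nonneg (y x), sq_nonneg (y' x)]
  · have h1 : |1 + g x| ≤ 1 + K := by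
      refine (abs_add_le _ _).trans ?_
      rw [abs_one]
      linarith [hg x hx]
    have h2 : 2 * |y x * y' x| ≤ y x ^ 2 + y' x ^ 2 := by
      rw [abs_mul, ← sq_abs (y x), ← sq_abs (y' x)]
      nlinarith [sq_nonneg (|y x| - |y' x|)]
    have h3 := abs_nonneg (y x * y' x)
    have h4 := abs_nonneg (1 + g x)
    calc |2 * (1 + g x) * (y x * y' x)| = |1 + g x| * (2 * |y x * y' x|) := by
          rw [abs_mul, abs_mul, abs_two]; ring
      _ ≤ (1 + K) * (y x ^ 2 + y' x ^ 2) :=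
          mul_le_mul h1 h2 (by positivity) (h4.trans h1)

theorem one_le_of_isDirichletEigenvalue {lam : ℝ} (hp : IsSmallDecreasing p)
    (h : IsDirichletEigenvalue (fun x => -p x) 0 1 lam) : 1 ≤ lam := by
  obtain ⟨y, y', hy, hy', ⟨x, hx, hxne⟩, h0, h1⟩ := h
  by_contra! hlam
  refine hxne ?_
  have hv : ∀ s ∈ Icc (0 : ℝ) 1, 0 < 1 - (s - 1 / 2) ^ 2 := fun s hs => by
    nlinarith [hs.1, hs.2]
  set G : ℝ → ℝ := fun s => y s * y' s - y s ^ 2 * (1 - 2 * s) / (1 - (s - 1 / 2) ^ 2) with hG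
  set G' : ℝ → ℝ := fun s => (y' s - y s * (1 - 2 * s) / (1 - (s - 1 / 2) ^ 2)) ^ 2 +
    y s ^ 2 * (-p s - lam + 2 / (1 - (s - 1 / 2) ^ 2)) with hG'
  have hder : ∀ s ∈ Icc (0 : ℝ) 1, HasDerivAt G (G' s) s := fun s hs => by
    have hvs := (hv s hs).ne'
    have h2 : HasDerivAt (fun s : ℝ => 1 - 2 * s) (-2) s :=
      (((hasDerivAt_id s).const_mul 2).const_sub 1).congr_deriv (by ring)
    have h3 : HasDerivAt (fun s : ℝ => 1 - (s - 1 / 2) ^ 2) (1 - 2 * s) s :=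
      ((((hasDerivAt_id s).sub_const (1 / 2)).pow 2).const_sub 1).congr_deriv
        (by simp only [id]; push_cast; ring)
    refine (((hy s hs).mul (hy' s hs)).sub
      ((((hy s hs).pow 2).mul h2).div h3 hvs)).congr_deriv ?_
    simp only [hG', Pi.pow_apply, Pi.mul_apply]
    generalize 1 - (s - 1 / 2) ^ 2 = V at hvs ⊢
    field_simp
    push_cast
    ring
  have hlow : ∀ s ∈ Icc (0 : ℝ) 1, y s ^ 2 / 2 ≤ G' s := fun s hs => by
    have h2 : 2 ≤ 2 / (1 - (s - 1 / 2) ^ 2) := by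
      rw [le_div_iff₀ (hv s hs)]
      nlinarith [sq_nonneg (s - 1 / 2)]
    have h3 : y s ^ 2 * (1 / 2) ≤ y s ^ 2 * (-p s - lam + 2 / (1 - (s - 1 / 2) ^ 2)) := by
      gcongr
      have := hp.le s
      linarith
    have := sq_nonneg (y' s - y s * (1 - 2 * s) / (1 - (s - 1 / 2) ^ 2))
    simp only [hG']
    linarith
  have hG0 : ∀ s ∈ Icc (0 : ℝ) 1, G s = 0 := fun s hs => by
    have hle : ∀ t ∈ Icc (0 : ℝ) 1, 0 ≤ G' t := fun t ht => by
      have := hlow t ht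
      have := sq_nonneg (y t)
      linarith
    have h2 := le_of_hasDerivAt_nonneg hs.1 (fun t ht => hder t ⟨ht.1, ht.2.trans hs.2⟩)
      (fun t ht => hle t ⟨ht.1, ht.2.trans hs.2⟩)
    have h3 := le_of_hasDerivAt_nonneg hs.2 (fun t ht => hder t ⟨hs.1.trans ht.1, ht.2⟩)
      (fun t ht => hle t ⟨hs.1.trans ht.1, ht.2⟩)
    have h4 : G 0 = 0 := by simp [hG, h0]
    have h5 : G 1 = 0 := by simp [hG, h1]
    linarith
  rcases hx.1.eq_or_lt with rfl | hx0
  · exact h0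
  rcases hx.2.eq_or_lt with rfl | hx1
  · exact h1
  have hev : G =ᶠ[𝓝 x] fun _ => 0 := by
    filter_upwards [Icc_mem_nhds hx0 hx1] with s hs using hG0 s hs
  have h2 := (hder x hx).unique ((hasDerivAt_const x (0 : ℝ)).congr_of_eventuallyEq hev)
  have h3 := hlow x hx
  rw [h2] at h3
  have h4 : y x ^ 2 = 0 := le_antisymm (by linarith) (sq_nonneg _)
  exact pow_eq_zero_iff two_ne_zero |>.1 h4

namespace IsAngle

theorem hasDerivAt_mul (hz : 1 ≤ z) (hθ : IsAngle p z θ) {x : ℝ} (hx : x ∈ Icc (0 : ℝ) 1) :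
    HasDerivAt (fun s => z * θ s) (z + p x / z * Real.sin (z * θ x) ^ 2) x := by
  have hz0 : z ≠ 0 := by positivity
  refine ((hθ.deriv x hx).const_mul z).congr_deriv ?_
  simp only [sinSq]
  field_simp

theorem abs_div_le_one (hp : IsSmallDecreasing p) (hz : 1 ≤ z) (x : ℝ) : |p x / z| ≤ 1 := by
  rw [abs_of_nonneg (div_nonneg (hp.nonneg x) (by linarith))]
  have := hp.le x
  exact div_le_one_of_le₀ (by linarith) (by linarith)

theorem sin_eq_zero (hp : IsSmallDecreasing p) (hz : 1 ≤ z) (hθ : IsAngle p z θ)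
    (h : IsDirichletEigenvalue (fun x => -p x) 0 1 (z ^ 2)) : Real.sin (z * θ 1) = 0 := by
  obtain ⟨y, y', hy, hy', ⟨x, hx, hxne⟩, h0, h1⟩ := h
  have hz0 : z ≠ 0 := by positivity
  set W : ℝ → ℝ := fun s => y s * z * Real.cos (z * θ s) - y' s * Real.sin (z * θ s) with hW
  have hder : ∀ s ∈ Icc (0 : ℝ) 1, HasDerivAt W
      (p s / z * (Real.sin (z * θ s) * Real.cos (z * θ s)) * W s) s := fun s hs => by
    have hφ := hθ.hasDerivAt_mul hz hs
    refine ((((hy s hs).mul_const z).mul hφ.cos).sub ((hy' s hs).mul hφ.sin)).congr_deriv ?_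
    have hsc := Real.sin_sq_add_cos_sq (z * θ s)
    simp only [hW]
    generalize Real.sin (z * θ s) = S at *
    generalize Real.cos (z * θ s) = C at *
    have hC : C ^ 2 = 1 - S ^ 2 := by linarith
    field_simp
    linear_combination (-y s * p s * S * z) * hC
  have hW0 := eq_zero_of_abs_deriv_le_mul (e := fun s => W s ^ 2)
    (e' := fun s => 2 * (p s / z * (Real.sin (z * θ s) * Real.cos (z * θ s))) * W s ^ 2)
    (K := 2) (c := 0) (a := 0) (b := 1)
    (fun s hs => ((hder s hs).pow 2).congr_deriv (by push_cast; ring))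
    (fun s _ => sq_nonneg _) (fun s hs => ?_) (left_mem_Icc.2 zero_le_one)
    (by simp [hW, h0, hθ.zero]) 1 (right_mem_Icc.2 zero_le_one)
  · have hW1 : W 1 = 0 := pow_eq_zero_iff two_ne_zero |>.1 hW0
    simp only [hW, h1, zero_mul, zero_sub, neg_eq_zero, mul_eq_zero] at hW1
    refine hW1.resolve_left fun h1' => hxne ?_
    refine eq_zero_of_initial_eq_zero (K := 1 + z ^ 2) hy hy' (fun s hs => ?_)
      (right_mem_Icc.2 zero_le_one) h1 h1' x hx
    have := hp.nonneg s
    have := hp.le s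
    have := sq_nonneg z
    rw [abs_le]
    constructor <;> linarith
  · rw [abs_mul, abs_mul, abs_mul, abs_mul, abs_two, abs_of_nonneg (sq_nonneg (W s))]
    have h2 := abs_div_le_one hp hz s
    have h3 := Real.abs_sin_le_one (z * θ s)
    have h4 := Real.abs_cos_le_one (z * θ s)
    calc _ ≤ 2 * (1 * (1 * 1)) * W s ^ 2 := by gcongr
      _ = _ := by ring

theorem isDirichletEigenvalue (hp : IsSmallDecreasing p) (hz : 1 ≤ z) (hθ : IsAngle p z θ)
    (h : Real.sin (z * θ 1) = 0) : IsDirichletEigenvalue (fun x => -p x) 0 1 (z ^ 2) := by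
  have hz0 : z ≠ 0 := by positivity
  have hz1 : 0 < z := by linarith
  set η : ℝ → ℝ := IccExtend (zero_le_one' ℝ) ((Icc 0 1).domRestrict θ) with hη
  have hηc : Continuous η := (continuousOn_iff_continuous_domRestrict.1 hθ.continuousOn).Icc_extend'
  have hηθ : ∀ x ∈ Icc (0 : ℝ) 1, η x = θ x := fun x hx => IccExtend_of_mem _ _ hx
  set g : ℝ → ℝ := fun x => -(p x / z * (Real.sin (z * η x) * Real.cos (z * η x))) with hg
  have hpc := hp.cont
  have hgc : Continuous g := by fun_prop
  set r : ℝ → ℝ := fun x => Real.exp (∫ t in (0 : ℝ)..x, g t) with hr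
  have hder : ∀ x ∈ Icc (0 : ℝ) 1, HasDerivAt r
      (-(r x * (p x / z * (Real.sin (z * θ x) * Real.cos (z * θ x))))) x := fun x hx => by
    refine (hgc.integral_hasStrictDerivAt 0 x).hasDerivAt.exp.congr_deriv ?_
    simp only [hg, hr, hηθ x hx]
    ring
  refine ⟨fun x => r x * Real.sin (z * θ x), fun x => z * (r x * Real.cos (z * θ x)),
    fun x hx => ?_, fun x hx => ?_, ⟨1 / z, ⟨by positivity, ?_⟩, ?_⟩, ?_, ?_⟩
  · refine ((hder x hx).mul (hθ.hasDerivAt_mul hz hx).sin).congr_deriv ?_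
    ring
  · refine (((hder x hx).mul (hθ.hasDerivAt_mul hz hx).cos).const_mul z).congr_deriv ?_
    have hsc := Real.sin_sq_add_cos_sq (z * θ x)
    beta_reduce
    generalize Real.sin (z * θ x) = S at *
    generalize Real.cos (z * θ x) = C at *
    have hC : C ^ 2 = 1 - S ^ 2 := by linarith
    field_simp
    linear_combination (-r x * p x * S) * hC
  · rw [div_le_one₀ hz1]; exact hz
  · have hmem : 1 / z ∈ Icc (0 : ℝ) 1 := ⟨by positivity, by rw [div_le_one₀ hz1]; exact hz⟩
    obtain ⟨h1, h2⟩ := hθ.le_self hp hz hmem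
    have h3 := mul_le_mul_of_nonneg_left h1 hz1.le
    have h4 := mul_le_mul_of_nonneg_left h2 hz1.le
    have h5 : z * (1 / z) = 1 := by field_simp
    have hpi := Real.pi_gt_three
    exact mul_ne_zero (Real.exp_ne_zero _)
      (Real.sin_pos_of_pos_of_lt_pi (by linarith) (by linarith)).ne'
  · simp [hθ.zero]
  · simp [h]

end IsAngle

/-- The Dirichlet spectrum of `-p` consists of squares of numbers `Z n` with `Z n / n`
nondecreasing. -/
theorem IsSmallDecreasing.exists_spectrum (hp : IsSmallDecreasing p) :
    ∃ Z : ℕ+ → ℝ, StrictMono Z ∧ (∀ n, 1 ≤ Z n) ∧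
      (∀ lam, IsDirichletEigenvalue (fun x => -p x) 0 1 lam ↔ ∃ n, lam = Z n ^ 2) ∧
      ∀ n m : ℕ+, m < n → (n : ℝ) / m ≤ Z n / Z m := by
  have hex : ∀ z : ℝ, ∃ θ, 1 ≤ z → IsAngle p z θ := fun z => by
    by_cases hz : 1 ≤ z
    · exact (exists_isAngle hp hz).imp fun _ h _ => h
    · exact ⟨0, fun h => absurd h hz⟩
  choose θ hθ using hex
  set Φ : ℝ → ℝ := fun z => z * θ z 1 with hΦ
  have hinc : ∀ z w, 1 ≤ z → z ≤ w → (w - z) / 2 ≤ Φ w - Φ z ∧ Φ w - Φ z ≤ 3 * (w - z) :=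
    fun z w hz hzw => (hθ z hz).mul_sub_mul_mem hp hz hzw (hθ w (hz.trans hzw))
  have hmono : StrictMonoOn Φ (Ici 1) := fun z hz w _ hzw => by
    have := (hinc z w hz hzw.le).1
    linarith
  have hcont : ContinuousOn Φ (Ici 1) := by
    have hL : LipschitzOnWith 3 Φ (Ici 1) := by
      refine LipschitzOnWith.of_le_add_mul 3 fun z hz w hw => ?_
      rw [Real.dist_eq]
      push_cast
      rcases le_total z w with h | h
      · have := (hinc z w hz h).1
        have := abs_nonneg (z - w)
        linarith
      · have := (hinc w z hw h).2
        rw [abs_of_nonneg (by linarith)]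
        linarith
    exact hL.continuousOn
  have hmem : ∀ z, 1 ≤ z → z ≤ Φ z ∧ Φ z ≤ 2 * z := fun z hz => by
    obtain ⟨h1, h2⟩ := (hθ z hz).le_self hp hz (right_mem_Icc.2 zero_le_one)
    simp only [hΦ]
    constructor <;> nlinarith
  have hdouble : ∀ (k : ℕ) (z w : ℝ), 1 ≤ z → z ≤ w → w ≤ 2 ^ k * z → θ w 1 ≤ θ z 1 := by
    intro k
    induction k with
    | zero =>
      intro z w hz hzw hw
      rw [le_antisymm hzw (by simpa using hw)]
    | succ k ih =>
      intro z w hz hzw hw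
      rcases le_total w (2 * z) with h | h
      · exact (hθ z hz).le_of_le_two_mul hp hz hzw h (hθ w (hz.trans hzw))
      · have h2 := (hθ z hz).le_of_le_two_mul hp hz (by linarith) le_rfl (hθ (2 * z) (by linarith))
        refine (ih (2 * z) w (by linarith) h ?_).trans h2
        rw [pow_succ] at hw
        linarith
  have hanti : ∀ z w, 1 ≤ z → z ≤ w → θ w 1 ≤ θ z 1 := fun z w hz hzw => by
    obtain ⟨k, hk⟩ := pow_unbounded_of_one_lt w (one_lt_two (α := ℝ))
    exact hdouble k z w hz hzw (hk.le.trans (le_mul_of_one_le_right (by positivity) hz))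
  have hpi := Real.pi_gt_three
  have hroot : ∀ n : ℕ+, ∃ z, 1 ≤ z ∧ Φ z = n * Real.pi := fun n => by
    have hn : (1 : ℝ) ≤ n := by exact_mod_cast Nat.one_le_iff_ne_zero.2 n.ne_zero
    have hn1 : 1 ≤ n * Real.pi := by nlinarith
    obtain ⟨z, hz, hzn⟩ := intermediate_value_Icc hn1 (hcont.mono Icc_subset_Ici_self)
      (show n * Real.pi ∈ Icc (Φ 1) (Φ (n * Real.pi)) from
        ⟨by have := (hmem 1 le_rfl).2; nlinarith, (hmem _ hn1).1⟩)
    exact ⟨z, hz.1, hzn⟩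
  choose Z hZ1 hZ using hroot
  have hZmono : StrictMono Z := fun m n hmn => by
    refine (hmono.lt_iff_lt (hZ1 m) (hZ1 n)).1 ?_
    rw [hZ, hZ]
    have : (m : ℝ) < n := by exact_mod_cast hmn
    exact mul_lt_mul_of_pos_right this Real.pi_pos
  refine ⟨Z, hZmono, hZ1, fun lam => ⟨fun h => ?_, ?_⟩, fun n m hmn => ?_⟩
  · have hlam := one_le_of_isDirichletEigenvalue hp h
    set z := √lam with hz
    have hzl : z ^ 2 = lam := Real.sq_sqrt (by linarith)
    have hz1 : 1 ≤ z := Real.one_le_sqrt.2 hlam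
    rw [← hzl] at h
    obtain ⟨k, hk⟩ := Real.sin_eq_zero_iff.1 ((hθ z hz1).sin_eq_zero hp hz1 h)
    have hk0 : 0 < k := by
      have h1 := (hmem z hz1).1
      have h2 : 0 < (k : ℝ) * Real.pi := by rw [hk]; linarith
      exact_mod_cast pos_of_mul_pos_left h2 Real.pi_pos.le
    lift k to ℕ using hk0.le
    refine ⟨k.toPNat (by exact_mod_cast hk0), ?_⟩
    rw [← hzl]
    congr 1
    refine hmono.injOn hz1 (hZ1 _) ?_
    rw [hZ]
    exact (by simpa using hk.symm : z * θ z 1 = (k : ℝ) * Real.pi)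
  · rintro ⟨n, rfl⟩
    refine (hθ _ (hZ1 n)).isDirichletEigenvalue hp (hZ1 n) ?_
    have := hZ n
    simp only [hΦ] at this
    rw [this]
    exact Real.sin_nat_mul_pi n
  · have h1 := hanti (Z m) (Z n) (hZ1 m) (hZmono hmn).le
    have hm : (0 : ℝ) < m := by exact_mod_cast m.pos
    have hZm : 0 < Z m := by linarith [hZ1 m]
    have hZn : 0 < Z n := by linarith [hZ1 n]
    have h2 : θ (Z n) 1 = n * Real.pi / Z n := by rw [← hZ n]; simp only [hΦ]; field_simp
    have h3 : θ (Z m) 1 = m * Real.pi / Z m := by rw [← hZ m]; simp only [hΦ]; field_simp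
    rw [h2, h3, div_le_div_iff₀ hZn hZm] at h1
    rw [div_le_div_iff₀ hm hZm]
    nlinarith [Real.pi_pos]

end

/-! ### Reduction to the unit interval -/

/-- An affine change of variables in the Dirichlet problem. -/
theorem isDirichletEigenvalue_affine {q Q : ℝ → ℝ} {a b c d α β lam : ℝ} (hβ : β ≠ 0)
    (hmaps : ∀ t ∈ Icc c d, α + β * t ∈ Icc a b) (hinv : ∀ x ∈ Icc a b, (x - α) / β ∈ Icc c d)
    (hends : (α + β * c = a ∧ α + β * d = b) ∨ (α + β * c = b ∧ α + β * d = a))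
    (hQ : ∀ t ∈ Icc c d, Q t = β ^ 2 * q (α + β * t)) (h : IsDirichletEigenvalue q a b lam) :
    IsDirichletEigenvalue Q c d (β ^ 2 * lam) := by
  obtain ⟨y, y', hy, hy', ⟨x, hx, hxne⟩, ha, hb⟩ := h
  have hlin : ∀ t, HasDerivAt (fun t => α + β * t) β t := fun t =>
    (((hasDerivAt_id t).const_mul β).const_add α).congr_deriv (mul_one β)
  refine ⟨fun t => y (α + β * t), fun t => β * y' (α + β * t), fun t ht => ?_, fun t ht => ?_,
    ⟨(x - α) / β, hinv x hx, ?_⟩, ?_, ?_⟩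
  · exact ((hy _ (hmaps t ht)).comp t (hlin t)).congr_deriv (mul_comm _ _)
  · refine (((hy' _ (hmaps t ht)).comp t (hlin t)).const_mul β).congr_deriv ?_
    rw [hQ t ht]
    ring
  · have : α + β * ((x - α) / β) = x := by field_simp; ring
    simpa only [this] using hxne
  · rcases hends with h | h <;> simp only [h.1, ha, hb]
  · rcases hends with h | h <;> simp only [h.2, ha, hb]

theorem ratio_bound_of_affine {q : ℝ → ℝ} {l α β : ℝ} (hl : 0 < l)
    (hαβ : (α = 0 ∧ β = l) ∨ (α = l ∧ β = -l)) (hcont : ContinuousOn q (Icc 0 l))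
    (hq : ∀ x ∈ Icc 0 l, q x ≤ 0) (hsmall : ∀ x ∈ Icc 0 l, -(l ^ 2 * q x) ≤ 1 / 100000)
    (hmono : MonotoneOn (fun t => q (α + β * t)) (Icc 0 1)) {μ : ℕ+ → ℝ} (hμ : StrictMono μ)
    (hμe : ∀ n, IsDirichletEigenvalue q 0 l (μ n))
    (hμs : ∀ lam, IsDirichletEigenvalue q 0 l lam → ∃ n, μ n = lam) :
    0 < μ 1 ∧ ∀ n m : ℕ+, m < n → (n : ℝ) ^ 2 / (m : ℝ) ^ 2 ≤ μ n / μ m := by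
  have hβ : β ≠ 0 := by rcases hαβ with h | h <;> simp [h.2, hl.ne']
  have hβ2 : β ^ 2 = l ^ 2 := by rcases hαβ with h | h <;> simp [h.2]
  have hmaps : ∀ t ∈ Icc (0 : ℝ) 1, α + β * t ∈ Icc 0 l := fun t ht => by
    rcases hαβ with ⟨rfl, rfl⟩ | ⟨rfl, rfl⟩ <;> constructor <;> nlinarith [ht.1, ht.2]
  have hinv : ∀ x ∈ Icc 0 l, (x - α) / β ∈ Icc (0 : ℝ) 1 := fun x hx => by
    rcases hαβ with ⟨rfl, rfl⟩ | ⟨rfl, rfl⟩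
    · rw [sub_zero]
      exact ⟨div_nonneg hx.1 hl.le, div_le_one_of_le₀ hx.2 hl.le⟩
    · rw [div_neg, ← neg_div, neg_sub]
      exact ⟨div_nonneg (by linarith [hx.2]) hl.le, div_le_one_of_le₀ (by linarith [hx.1]) hl.le⟩
  have hends : (α + β * 0 = 0 ∧ α + β * 1 = l) ∨ (α + β * 0 = l ∧ α + β * 1 = 0) := by
    rcases hαβ with ⟨rfl, rfl⟩ | ⟨rfl, rfl⟩ <;> simp
  set f : ℝ → ℝ := fun t => -(β ^ 2 * q (α + β * t)) with hf
  set p : ℝ → ℝ := IccExtend (zero_le_one' ℝ) ((Icc 0 1).domRestrict f) with hp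
  have hpf : ∀ t ∈ Icc (0 : ℝ) 1, p t = f t := fun t ht => IccExtend_of_mem _ _ ht
  have hfc : ContinuousOn f (Icc 0 1) :=
    (continuousOn_const.mul (hcont.comp (by fun_prop) hmaps)).neg
  have hsd : IsSmallDecreasing p := by
    refine ⟨(continuousOn_iff_continuous_domRestrict.1 hfc).Icc_extend', ?_, fun x => ?_,
      fun x => ?_⟩
    · have h1 : Antitone ((Icc (0 : ℝ) 1).domRestrict f) := fun s t hst =>
        neg_le_neg (mul_le_mul_of_nonneg_left (hmono s.2 t.2 hst) (sq_nonneg β))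
      exact fun s t hst => h1 (monotone_projIcc (zero_le_one' ℝ) hst)
    · have := hq _ (hmaps _ (projIcc (0 : ℝ) 1 zero_le_one x).2)
      exact neg_nonneg.2 (mul_nonpos_of_nonneg_of_nonpos (sq_nonneg β) this)
    · have := hsmall _ (hmaps _ (projIcc (0 : ℝ) 1 zero_le_one x).2)
      rw [← hβ2] at this
      exact this
  obtain ⟨Z, hZ, hZ1, hspec, hratio⟩ := hsd.exists_spectrum
  have hforward : ∀ lam, IsDirichletEigenvalue q 0 l lam → ∃ n, β ^ 2 * lam = Z n ^ 2 :=
    fun lam h => (hspec _).1 (isDirichletEigenvalue_affine hβ hmaps hinv hends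
      (fun t ht => by simp only [hpf t ht, hf, neg_neg]) h)
  have hbackward : ∀ n, IsDirichletEigenvalue q 0 l (β⁻¹ ^ 2 * Z n ^ 2) := fun n => by
    have hlin : ∀ x, -α / β + β⁻¹ * x = (x - α) / β := fun x => by field_simp; ring
    refine isDirichletEigenvalue_affine (α := -α / β) (inv_ne_zero hβ)
      (fun x hx => by rw [hlin]; exact hinv x hx) (fun t ht => ?_) ?_ (fun x hx => ?_)
      ((hspec _).2 ⟨n, rfl⟩)
    · have : (t - -α / β) / β⁻¹ = α + β * t := by field_simp; ring
      rw [this]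
      exact hmaps t ht
    · simp only [hlin, div_eq_iff hβ]
      rcases hends with h | h
      · exact Or.inl ⟨by linarith, by linarith⟩
      · exact Or.inr ⟨by linarith, by linarith⟩
    · rw [hlin, hpf _ (hinv x hx)]
      simp only [hf, neg_neg]
      have : α + β * ((x - α) / β) = x := by field_simp; ring
      rw [this]
      field_simp
  have hβ2pos : 0 < β ^ 2 := by positivity
  have heq : (fun n => β ^ 2 * μ n) = fun n => Z n ^ 2 := by
    refine (StrictMono.range_inj (fun m n hmn => mul_lt_mul_of_pos_left (hμ hmn) hβ2pos)
      (fun m n hmn => pow_lt_pow_left₀ (hZ hmn) (by linarith [hZ1 m]) two_ne_zero)).1 ?_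
    ext v
    constructor
    · rintro ⟨n, rfl⟩
      obtain ⟨k, hk⟩ := hforward _ (hμe n)
      exact ⟨k, hk.symm⟩
    · rintro ⟨n, rfl⟩
      obtain ⟨k, hk⟩ := hμs _ (hbackward n)
      refine ⟨k, ?_⟩
      simp only [hk]
      field_simp
  have hμZ : ∀ n, μ n = Z n ^ 2 / β ^ 2 := fun n => by
    rw [eq_div_iff hβ2pos.ne', mul_comm]
    exact congrFun heq n
  refine ⟨?_, fun n m hmn => ?_⟩
  · rw [hμZ]
    have := hZ1 1
    positivity
  · have h := hratio n m hmn
    rw [hμZ, hμZ, div_div_div_cancel_right₀ hβ2pos.ne', ← div_pow, ← div_pow]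
    gcongr

end DirichletRatio

/-!
**Statement 4.**  Let `q : [0,1] → ℝ` be continuous, nonpositive and single-barrier.
Then there exists `ℓ₀ ∈ (0,1]` such that, denoting by `λ₁(ℓ₀) < λ₂(ℓ₀) < ⋯` the
eigenvalues of the Dirichlet problem `−y'' + q y = λ y` on `[0,ℓ₀]`,
`y 0 = y ℓ₀ = 0`, one has `λ₁(ℓ₀) > 0` and `λ_n(ℓ₀) / λ_m(ℓ₀) ≥ n² / m²` for all
`n > m ≥ 1`.
-/
theorem exists_truncation_with_eigenvalue_ratio_bound
    (q : ℝ → ℝ) (x₀ : ℝ) (hx₀ : x₀ ∈ Set.Icc (0 : ℝ) 1)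
    (hq_cont : ContinuousOn q (Set.Icc 0 1))
    (hq_nonpos : ∀ x ∈ Set.Icc (0 : ℝ) 1, q x ≤ 0)
    (hq_inc : MonotoneOn q (Set.Icc 0 x₀))
    (hq_dec : AntitoneOn q (Set.Icc x₀ 1)) :
    ∃ l₀ ∈ Set.Ioc (0 : ℝ) 1,
      ∀ μ : ℕ+ → ℝ, StrictMono μ →
        (∀ n : ℕ+, IsDirichletEigenvalue q 0 l₀ (μ n)) →
        (∀ lam : ℝ, IsDirichletEigenvalue q 0 l₀ lam → ∃ n : ℕ+, μ n = lam) →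
        0 < μ 1 ∧ ∀ n m : ℕ+, m < n →
          (n : ℝ) ^ 2 / (m : ℝ) ^ 2 ≤ μ n / μ m := by
  obtain ⟨M, hM⟩ := isCompact_Icc.exists_bound_of_continuousOn hq_cont
  have hM0 : 0 ≤ M := (norm_nonneg _).trans (hM 0 (by simp))
  set δ : ℝ := 1 / (100000 * (M + 1)) with hδ
  have hδ0 : 0 < δ := by positivity
  have hδ1 : δ ≤ 1 := by
    rw [hδ, div_le_one₀ (by positivity)]
    linarith
  have hδM : δ * M ≤ 1 / 100000 := by
    rw [hδ, div_mul_eq_mul_div, div_le_div_iff₀ (by positivity) (by norm_num)]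
    linarith
  have hsmall : ∀ l, 0 < l → l ≤ δ → ∀ x ∈ Set.Icc 0 l, -(l ^ 2 * q x) ≤ 1 / 100000 :=
    fun l hl hlδ x hx => by
      have h1 := (abs_le.1 (hM x ⟨hx.1, hx.2.trans (hlδ.trans hδ1)⟩)).1
      calc -(l ^ 2 * q x) ≤ l ^ 2 * M := by nlinarith [sq_nonneg l]
        _ ≤ δ * M := by gcongr; nlinarith
        _ ≤ _ := hδM
  rcases hx₀.1.eq_or_lt with rfl | hpos
  · have hsub : Set.Icc 0 δ ⊆ Set.Icc 0 1 := Set.Icc_subset_Icc_right hδ1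
    refine ⟨δ, ⟨hδ0, hδ1⟩, fun μ hμ hμe hμs => DirichletRatio.ratio_bound_of_affine hδ0
      (Or.inr ⟨rfl, rfl⟩) (hq_cont.mono hsub) (fun x hx => hq_nonpos x (hsub hx))
      (hsmall δ hδ0 le_rfl) (fun s hs t ht hst => ?_) hμ hμe hμs⟩
    refine hq_dec ⟨?_, ?_⟩ ⟨?_, ?_⟩ ?_ <;> nlinarith [hs.1, hs.2, ht.1, ht.2]
  · have hl0 : 0 < min x₀ δ := lt_min hpos hδ0
    have hl1 : min x₀ δ ≤ x₀ := min_le_left _ _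
    have hlδ : min x₀ δ ≤ δ := min_le_right _ _
    generalize min x₀ δ = l at hl0 hl1 hlδ
    have hsub : Set.Icc 0 l ⊆ Set.Icc 0 1 := Set.Icc_subset_Icc_right (hlδ.trans hδ1)
    refine ⟨l, ⟨hl0, hlδ.trans hδ1⟩, fun μ hμ hμe hμs => DirichletRatio.ratio_bound_of_affine hl0
      (Or.inl ⟨rfl, rfl⟩) (hq_cont.mono hsub) (fun x hx => hq_nonpos x (hsub hx))
      (hsmall l hl0 hlδ) (fun s hs t ht hst => ?_) hμ hμe hμs⟩
    refine hq_inc ⟨?_, ?_⟩ ⟨?_, ?_⟩ ?_ <;> nlinarith [hs.1, hs.2, ht.1, ht.2]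
end
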